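/- arXiv:2512.19461 — 3 statements merged into one kernel-verified Lean document; each statement's English description precedes it below -/
import Mathlib

section
/- The 2-fold fibred join q(1) : E(1) → ℍP² of the twistor map q admits no continuous section; that is, there is no continuous map s : ℍP² → E(1) with q(1) ∘ s equal to the identity of ℍP². -/
noncomputable section

open Quaternion

/-- The standard inclusion of `ℂ` into the quaternions `ℍ`. -/
def cq (z : ℂ) : ℍ[ℝ] := ⟨z.re, z.im, 0, 0⟩

lemma cq_ne_zero {z : ℂ} (hz : z ≠ 0) : cq z ≠ 0 := by
  intro h
  apply hz
  have h1 : (cq z).re = 0 := by rw [h]; rfl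
  have h2 : (cq z).imI = 0 := by rw [h]; rfl
  exact Complex.ext h1 h2

/-- Nonzero vectors of `ℍ³`. -/
abbrev V3x : Type := {v : Fin 3 → ℍ[ℝ] // v ≠ 0}

/-- Two nonzero vectors of `ℍ³` span the same complex line. -/
def crel (v w : V3x) : Prop := ∃ c : ℂ, c ≠ 0 ∧ w.1 = fun i => v.1 i * cq c

/-- Two nonzero vectors of `ℍ³` span the same quaternionic line. -/
def hrel (v w : V3x) : Prop := ∃ a : ℍ[ℝ], a ≠ 0 ∧ w.1 = fun i => v.1 i * a

/-- `ℂP⁵`, the space of complex lines in `ℍ³ ≅ ℂ⁶`, with the quotient topology. -/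
def CP5 : Type := Quot crel

/-- `ℍP²`, the space of quaternionic lines in `ℍ³`, with the quotient topology. -/
def HP2 : Type := Quot hrel

instance : TopologicalSpace CP5 := instTopologicalSpaceQuot
instance : TopologicalSpace HP2 := instTopologicalSpaceQuot

/-- The twistor map `ℂP⁵ → ℍP²`, sending the complex line spanned by `v` to the
quaternionic line spanned by `v`. -/
def twistor : CP5 → HP2 :=
  Quot.lift (fun v => Quot.mk hrel v)
    (fun _ _ ⟨c, hc, hw⟩ => Quot.sound ⟨cq c, cq_ne_zero hc, hw⟩)

open unitInterval

/-- The underlying space of the 2-fold fibred join of the twistor map, before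
quotienting: triples `(e₀, e₁, t)` with `q e₀ = q e₁`. -/
def JSp : Type := {p : CP5 × CP5 × I // twistor p.1 = twistor p.2.1}

instance : TopologicalSpace JSp := instTopologicalSpaceSubtype

/-- The join identifications: `(e₀, e₁, 0) ∼ (e₀, e₁', 0)` and
`(e₀, e₁, 1) ∼ (e₀', e₁, 1)`. -/
def jrel (x y : JSp) : Prop :=
  (x.1.2.2 = 0 ∧ y.1.2.2 = 0 ∧ x.1.1 = y.1.1) ∨
  (x.1.2.2 = 1 ∧ y.1.2.2 = 1 ∧ x.1.2.1 = y.1.2.1)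

/-- The total space `E(1)` of the 2-fold fibred join of the twistor map, with
the quotient topology. -/
def E1 : Type := Quot jrel

instance : TopologicalSpace E1 := instTopologicalSpaceQuot

/-- The 2-fold fibred join `q(1) : E(1) → ℍP²` of the twistor map. -/
def q1 : E1 → HP2 :=
  Quot.lift (fun x => twistor x.1.1) (by
    rintro x y (⟨_, _, h⟩ | ⟨_, _, h⟩) <;>
      show twistor x.1.1 = twistor y.1.1
    · rw [h]
    · rw [x.2, h]; exact y.2.symm)

namespace GaussianMoments

section Moments

open MeasureTheory ComplexConjugate

lemma integrable_norm_pow_mul_exp (k : ℕ) :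
    Integrable (fun z : ℂ => ‖z‖ ^ k * Real.exp (-‖z‖ ^ 2)) := by
  apply Integrable.of_integral_ne_zero
  have h := Complex.integral_rpow_mul_exp_neg_rpow (p := 2) (q := k) (by norm_num)
    (by have : (0 : ℝ) ≤ k := k.cast_nonneg
        linarith)
  simp only [Real.rpow_natCast, Real.rpow_two] at h
  rw [h]
  have : 0 < Real.Gamma ((k + 2 : ℝ) / 2) := Real.Gamma_pos_of_pos (by positivity)
  positivity

lemma integrable_moment (a b : ℕ) :
    Integrable (fun z : ℂ => conj z ^ a * z ^ b * (Real.exp (-‖z‖ ^ 2) : ℂ)) := by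
  refine (integrable_norm_pow_mul_exp (a + b)).mono' (by fun_prop) (.of_forall fun z => ?_)
  simp [pow_add, Complex.norm_exp, -Complex.ofReal_pow]

lemma exists_unit_pow_ne {a b : ℕ} (h : a ≠ b) :
    ∃ u : ℂ, ‖u‖ = 1 ∧ conj u ^ a * u ^ b = -1 := by
  have hab : (b : ℂ) - a ≠ 0 := sub_ne_zero.2 (by exact_mod_cast h.symm)
  have hc : conj (Complex.exp ((Real.pi / (b - a) : ℝ) * Complex.I))
      = Complex.exp (-((Real.pi / (b - a) : ℝ) * Complex.I)) := by
    rw [← Complex.exp_conj]; simp [Complex.conj_ofReal]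
  refine ⟨Complex.exp ((Real.pi / (b - a) : ℝ) * Complex.I), Complex.norm_exp_ofReal_mul_I _, ?_⟩
  rw [hc, ← Complex.exp_nat_mul, ← Complex.exp_nat_mul, ← Complex.exp_add, ← Complex.exp_pi_mul_I]
  congr 1
  push_cast
  field_simp
  ring

lemma integral_moment (a b : ℕ) :
    ∫ z : ℂ, conj z ^ a * z ^ b * (Real.exp (-‖z‖ ^ 2) : ℂ)
      = if a = b then (Real.pi * a.factorial : ℂ) else 0 := by
  split_ifs with h
  · subst h
    have h := Complex.integral_rpow_mul_exp_neg_rpow (p := 2) (q := (2 * a : ℕ)) (by norm_num)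
      (by have : (0 : ℝ) ≤ (2 * a : ℕ) := Nat.cast_nonneg _
          linarith)
    simp only [Real.rpow_natCast, Real.rpow_two] at h
    have h2 : Real.Gamma (((2 * a : ℕ) + 2 : ℝ) / 2) = a.factorial := by
      rw [← Real.Gamma_nat_eq_factorial]; congr 1; push_cast; ring
    rw [h2] at h
    have h3 : ∀ z : ℂ, conj z ^ a * z ^ a * (Real.exp (-‖z‖ ^ 2) : ℂ)
        = ((‖z‖ ^ (2 * a) * Real.exp (-‖z‖ ^ 2) : ℝ) : ℂ) := by
      intro z
      rw [← mul_pow, Complex.conj_mul', pow_mul]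
      push_cast
      rfl
    simp_rw [h3]
    rw [integral_complex_ofReal, h]
    push_cast
    ring
  · obtain ⟨u, hu, hu'⟩ := exists_unit_pow_ne h
    have hmem : u ∈ Submonoid.unitSphere ℂ := mem_sphere_zero_iff_norm.2 hu
    have hinv : ∫ z : ℂ, conj (u * z) ^ a * (u * z) ^ b * (Real.exp (-‖u * z‖ ^ 2) : ℂ)
        = ∫ z : ℂ, conj z ^ a * z ^ b * (Real.exp (-‖z‖ ^ 2) : ℂ) :=
      ((rotation (⟨u, hmem⟩ : Circle)).measurePreserving).integral_comp
        (rotation _).toHomeomorph.measurableEmbedding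
        (fun z : ℂ => conj z ^ a * z ^ b * (Real.exp (-‖z‖ ^ 2) : ℂ))
    have h3 : ∀ z : ℂ, conj (u * z) ^ a * (u * z) ^ b * (Real.exp (-‖u * z‖ ^ 2) : ℂ)
      = - (conj z ^ a * z ^ b * (Real.exp (-‖z‖ ^ 2) : ℂ)) := by
      intro z
      rw [norm_mul, hu, one_mul, map_mul, mul_pow, mul_pow]
      linear_combination (conj z ^ a * z ^ b * (Real.exp (-‖z‖ ^ 2) : ℂ)) * hu'
    simp_rw [h3] at hinv
    rw [integral_neg] at hinv
    exact self_eq_neg.1 hinv.symm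

variable {ι : Type} [Fintype ι]

open MvPolynomial

lemma norm_toLp_sq (z : ι → ℂ) : ‖WithLp.toLp 2 z‖ ^ 2 = ∑ i, ‖z i‖ ^ 2 := by
  simp [EuclideanSpace.norm_sq_eq]

/-- The integrand of the Bargmann inner product of two polynomials. -/
def bargmannIntegrand (p q : MvPolynomial ι ℂ) (z : ι → ℂ) : ℂ :=
  conj (eval z p) * eval z q * (Real.exp (-‖WithLp.toLp 2 z‖ ^ 2) : ℂ)

lemma bargmannIntegrand_monomial (a b : ι →₀ ℕ) (c d : ℂ) (z : ι → ℂ) :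
    bargmannIntegrand (monomial a c) (monomial b d) z
      = conj c * d * ∏ i, (conj (z i) ^ a i * z i ^ b i * (Real.exp (-‖z i‖ ^ 2) : ℂ)) := by
  simp only [bargmannIntegrand, norm_toLp_sq]
  rw [← Finset.sum_neg_distrib, Real.exp_sum]
  simp only [eval_monomial, Finsupp.prod_pow, map_mul, map_prod, map_pow, Finset.prod_mul_distrib,
    Complex.ofReal_prod]
  ring

lemma integrable_bargmannIntegrand (p q : MvPolynomial ι ℂ) :
    Integrable (bargmannIntegrand p q) := by
  induction p using MvPolynomial.induction_on' with
  | add p p' hp hp' =>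
    refine (hp.add hp').congr (.of_forall fun z => ?_)
    simp [bargmannIntegrand]; ring
  | monomial a c =>
    induction q using MvPolynomial.induction_on' with
    | add q q' hq hq' =>
      refine (hq.add hq').congr (.of_forall fun z => ?_)
      simp [bargmannIntegrand]; ring
    | monomial b d =>
      simp_rw [funext (bargmannIntegrand_monomial a b c d)]
      exact (Integrable.fintype_prod fun i => integrable_moment (a i) (b i)).const_mul _

/-- The Bargmann inner product of two polynomials. -/
def bargmann (p q : MvPolynomial ι ℂ) : ℂ := ∫ z, bargmannIntegrand p q z

lemma bargmann_add_left (p p' q : MvPolynomial ι ℂ) :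
    bargmann (p + p') q = bargmann p q + bargmann p' q := by
  rw [bargmann, bargmann, bargmann, ← integral_add (integrable_bargmannIntegrand _ _)
    (integrable_bargmannIntegrand _ _)]
  congr 1; ext z; simp [bargmannIntegrand]; ring

lemma bargmann_add_right (p q q' : MvPolynomial ι ℂ) :
    bargmann p (q + q') = bargmann p q + bargmann p q' := by
  rw [bargmann, bargmann, bargmann, ← integral_add (integrable_bargmannIntegrand _ _)
    (integrable_bargmannIntegrand _ _)]
  congr 1; ext z; simp [bargmannIntegrand]; ring

lemma bargmann_monomial (a b : ι →₀ ℕ) (c d : ℂ) :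
    bargmann (monomial a c) (monomial b d)
      = conj c * d * ∏ i, if a i = b i then (Real.pi * (a i).factorial : ℂ) else 0 := by
  rw [bargmann, funext (bargmannIntegrand_monomial a b c d), integral_const_mul]
  erw [integral_fintype_prod_volume_eq_prod (𝕜 := ℂ)
    (fun i (x : ℂ) => conj x ^ a i * x ^ b i * (Real.exp (-‖x‖ ^ 2) : ℂ))]
  simp_rw [integral_moment]

/-- Multiplication by a coordinate is adjoint to the corresponding derivative. -/
lemma bargmann_X_mul (i : ι) (p q : MvPolynomial ι ℂ) :
    bargmann (X i * p) q = bargmann p (pderiv i q) := by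
  classical
  induction p using MvPolynomial.induction_on' with
  | add p p' hp hp' => rw [mul_add, bargmann_add_left, bargmann_add_left, hp, hp']
  | monomial a c =>
    induction q using MvPolynomial.induction_on' with
    | add q q' hq hq' => rw [map_add, bargmann_add_right, bargmann_add_right, hq, hq']
    | monomial b d =>
      rw [X, monomial_mul, one_mul, pderiv_monomial, bargmann_monomial, bargmann_monomial,
        ← Finset.mul_prod_erase Finset.univ _ (Finset.mem_univ i),
        ← Finset.mul_prod_erase Finset.univ _ (Finset.mem_univ i)]
      have h : ∀ j ∈ Finset.univ.erase i,
          (if (Finsupp.single i 1 + a : ι →₀ ℕ) j = b j then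
            (Real.pi * ((Finsupp.single i 1 + a : ι →₀ ℕ) j).factorial : ℂ) else 0)
          = if a j = (b - Finsupp.single i 1 : ι →₀ ℕ) j
            then (Real.pi * (a j).factorial : ℂ) else 0 := by
        intro j hj
        have := Finset.ne_of_mem_erase hj
        simp [this.symm]
      rw [Finset.prod_congr rfl h]
      rcases Nat.eq_zero_or_pos (b i) with hb | hb
      · simp [hb]
      · by_cases hab : 1 + a i = b i
        · have : a i = b i - 1 := by omega
          rw [if_pos (by simpa using hab), if_pos (by simpa using this)]
          simp only [Finsupp.add_apply, Finsupp.single_eq_same, ← hab, add_comm 1,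
            Nat.factorial_succ]
          push_cast
          ring
        · have : a i ≠ b i - 1 := by omega
          simp [hab, this]

end Moments

section Harmonic

open MeasureTheory ComplexConjugate

section Polar

open Set Metric Module

variable {E : Type} [NormedAddCommGroup E] [NormedSpace ℝ E] [MeasurableSpace E] [BorelSpace E]
  [Nontrivial E] [FiniteDimensional ℝ E]

lemma integral_volumeIoiPow_gaussian (n k : ℕ) :
    ∫ r : Ioi (0 : ℝ), ((r : ℝ) ^ k * Real.exp (-(r : ℝ) ^ 2)) ∂(Measure.volumeIoiPow n)
      = Real.Gamma ((k + n + 1 : ℝ) / 2) / 2 := by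
  have h := integral_rpow_mul_exp_neg_rpow (p := 2) (q := (k + n : ℕ)) (by norm_num)
    (by have : (0 : ℝ) ≤ (k + n : ℕ) := Nat.cast_nonneg _
        linarith)
  simp only [Real.rpow_natCast, Real.rpow_two] at h
  simp only [Measure.volumeIoiPow, ENNReal.ofReal]
  rw [integral_withDensity_eq_integral_smul,
    integral_subtype_comap measurableSet_Ioi
      fun a : ℝ ↦ Real.toNNReal (a ^ n) • (a ^ k * Real.exp (-a ^ 2)),
    setIntegral_congr_fun (g := fun a : ℝ => a ^ (k + n) * Real.exp (-a ^ 2)) measurableSet_Ioi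
      fun x hx ↦ ?_, h]
  · push_cast; ring
  · simp only [NNReal.smul_def, Real.coe_toNNReal _ (pow_nonneg (mem_Ioi.1 hx).le _), smul_eq_mul]
    ring
  · exact (measurable_subtype_coe.pow_const _).real_toNNReal

/-- Polar coordinates for a homogeneous function against the Gaussian weight. -/
lemma integral_homogeneous_mul_gaussian (μ : Measure E) [μ.IsAddHaarMeasure] (h : E → ℂ) (k : ℕ)
    (hh : ∀ r : ℝ, 0 < r → ∀ x, h (r • x) = r ^ k * h x) :
    ∫ x, h x * (Real.exp (-‖x‖ ^ 2) : ℂ) ∂μ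
      = (Real.Gamma ((k + finrank ℝ E : ℝ) / 2) / 2 : ℝ) *
        ∫ x : sphere (0 : E) 1, h x ∂μ.toSphere := by
  have hpos : 0 < finrank ℝ E := finrank_pos
  have key : ∀ x : ({(0)}ᶜ : Set E), h x * (Real.exp (-‖x.1‖ ^ 2) : ℂ)
      = (fun y : sphere (0 : E) 1 × Ioi (0 : ℝ) =>
          h y.1 * (((y.2 : ℝ) ^ k * Real.exp (-(y.2 : ℝ) ^ 2) : ℝ) : ℂ))
        (homeomorphUnitSphereProd E x) := by
    intro x
    have hx : 0 < ‖x.1‖ := norm_pos_iff.2 x.2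
    have h1 : h x.1 = ‖x.1‖ ^ k * h (homeomorphUnitSphereProd E x).1 := by
      rw [← hh _ hx]
      congr 1
      simp [smul_smul, hx.ne']
    simp only [homeomorphUnitSphereProd_apply_snd_coe]
    rw [h1]
    push_cast
    ring
  calc
    _ = ∫ x : ({(0)}ᶜ : Set E), h x * (Real.exp (-‖x.1‖ ^ 2) : ℂ) ∂(μ.comap (↑)) := by
      rw [integral_subtype_comap (measurableSet_singleton _).compl
        fun x ↦ h x * (Real.exp (-‖x‖ ^ 2) : ℂ), restrict_compl_singleton]
    _ = ∫ y : sphere (0 : E) 1 × Ioi (0 : ℝ),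
          h y.1 * (((y.2 : ℝ) ^ k * Real.exp (-(y.2 : ℝ) ^ 2) : ℝ) : ℂ)
          ∂μ.toSphere.prod (.volumeIoiPow (finrank ℝ E - 1)) := by
      rw [integral_congr_ae (.of_forall key)]
      exact μ.measurePreserving_homeomorphUnitSphereProd.integral_comp
        (Homeomorph.measurableEmbedding _) (fun y : sphere (0 : E) 1 × Ioi (0 : ℝ) =>
          h y.1 * (((y.2 : ℝ) ^ k * Real.exp (-(y.2 : ℝ) ^ 2) : ℝ) : ℂ))
    _ = _ := by
      rw [integral_prod_mul (fun x : sphere (0 : E) 1 => h x)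
        (fun r : Ioi (0 : ℝ) => (((r : ℝ) ^ k * Real.exp (-(r : ℝ) ^ 2) : ℝ) : ℂ)),
        integral_complex_ofReal, integral_volumeIoiPow_gaussian, mul_comm]
      congr 4
      rw [Nat.cast_pred hpos]
      ring

end Polar

section Sphere

open Set Metric Module

variable {E : Type} [NormedAddCommGroup E] [InnerProductSpace ℝ E]

/-- A linear isometry restricted to the unit sphere. -/
def sphereMap (L : E ≃ₗᵢ[ℝ] E) (x : sphere (0 : E) 1) : sphere (0 : E) 1 :=
  ⟨L x, by simp⟩

lemma continuous_sphereMap (L : E ≃ₗᵢ[ℝ] E) : Continuous (sphereMap L) :=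
  (L.continuous.comp continuous_subtype_val).subtype_mk _

variable [MeasurableSpace E] [BorelSpace E] [Nontrivial E] [FiniteDimensional ℝ E]

lemma integral_comp_sphereMap (L : E ≃ₗᵢ[ℝ] E) (F : sphere (0 : E) 1 → ℂ) :
    ∫ x, F (sphereMap L x) ∂(volume : Measure E).toSphere
      = ∫ x, F x ∂(volume : Measure E).toSphere := by
  classical
  let h : E → ℂ := fun z => if hz : z = 0 then 0 else
    F ⟨‖z‖⁻¹ • z, by simp [norm_smul, hz]⟩
  have h0 : ∀ r : ℝ, 0 < r → ∀ x, h (r • x) = r ^ 0 * h x := by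
    intro r hr x
    by_cases hx : x = 0
    · simp [h, hx]
    · simp only [h, hx, smul_eq_zero, hr.ne', or_self, dite_false, pow_zero, one_mul]
      congr 2
      rw [norm_smul, Real.norm_of_nonneg hr.le, smul_smul]
      congr 1
      field_simp
  have hS : ∀ x : sphere (0 : E) 1, h x = F x := by
    intro x
    have hx : (x : E) ≠ 0 := ne_zero_of_mem_unit_sphere x
    simp [h, hx]
  have h1 := integral_homogeneous_mul_gaussian volume h 0 (by simpa using h0)
  have h2 := integral_homogeneous_mul_gaussian volume (fun z => h (L z)) 0
    (fun r hr x => by simpa using h0 r hr (L x))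
  have h3 : ∫ x, h (L x) * (Real.exp (-‖x‖ ^ 2) : ℂ) = ∫ x, h x * (Real.exp (-‖x‖ ^ 2) : ℂ) := by
    rw [← L.measurePreserving.integral_comp L.toHomeomorph.measurableEmbedding
      (fun x => h x * (Real.exp (-‖x‖ ^ 2) : ℂ))]
    simp
  have h4 : ∀ x : sphere (0 : E) 1, h (L x) = F (sphereMap L x) := fun x => hS (sphereMap L x)
  have hG : 0 < Real.Gamma (((0 : ℕ) + finrank ℝ E : ℝ) / 2) := by
    apply Real.Gamma_pos_of_pos
    have : 0 < finrank ℝ E := finrank_pos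
    positivity
  rw [h1, h2] at h3
  simp_rw [h4, hS] at h3
  refine mul_left_cancel₀ ?_ h3
  exact_mod_cast (half_pos hG).ne'

end Sphere

section SpherePolynomials

open Module MvPolynomial Metric

variable {ι : Type} [Fintype ι] [Nonempty ι]

lemma finrank_real_euclideanSpace :
    finrank ℝ (EuclideanSpace ℂ ι) = 2 * Fintype.card ι := by
  rw [← finrank_mul_finrank ℝ ℂ (EuclideanSpace ℂ ι)]
  simp

lemma eval_smul_of_isHomogeneous {κ : Type} {p : MvPolynomial κ ℂ} {m : ℕ}
    (hp : p.IsHomogeneous m)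
    (c : ℂ) (x : κ → ℂ) : eval (c • x) p = c ^ m * eval x p := by
  rw [eval_eq, eval_eq, Finset.mul_sum]
  refine Finset.sum_congr rfl fun d hd => ?_
  have : d.degree = m := by
    have := hp (mem_support_iff.1 hd)
    rw [Finsupp.degree_eq_weight_one (R := ℕ)]
    exact this
  simp only [Pi.smul_apply, smul_eq_mul, mul_pow, Finset.prod_mul_distrib,
    Finset.prod_pow_eq_pow_sum]
  rw [← this, Finsupp.degree_apply]
  ring

lemma exists_bargmann_eq_sphere : ∃ c : ℝ, 0 < c ∧ ∀ (m : ℕ) (p q : MvPolynomial ι ℂ),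
    p.IsHomogeneous m → q.IsHomogeneous m →
    bargmann p q = c * (Real.Gamma (m + Fintype.card ι) *
      ∫ x : sphere (0 : EuclideanSpace ℂ ι) 1, eval x.1.ofLp q * conj (eval x.1.ofLp p)
        ∂(volume : Measure (EuclideanSpace ℂ ι)).toSphere) := by
  let e := (PiLp.continuousLinearEquiv 2 ℝ (fun _ : ι => ℂ)).symm
  let μ : Measure (EuclideanSpace ℂ ι) := Measure.map e volume
  have : μ.IsAddHaarMeasure := ContinuousLinearEquiv.isAddHaarMeasure_map e volume
  obtain ⟨c, hc, hμ⟩ : ∃ c : NNReal, 0 < c ∧ μ = c • volume :=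
    ⟨_, Measure.addHaarScalarFactor_pos_of_isAddHaarMeasure μ volume,
      Measure.isAddLeftInvariant_eq_smul μ volume⟩
  refine ⟨c / 2, half_pos (by exact_mod_cast hc), fun m p q hp hq => ?_⟩
  have h1 : bargmann p q = ∫ x : EuclideanSpace ℂ ι,
      (eval x.ofLp q * conj (eval x.ofLp p)) * (Real.exp (-‖x‖ ^ 2) : ℂ) ∂μ := by
    refine Eq.trans ?_ (e.toHomeomorph.measurableEmbedding.integral_map _).symm
    rw [bargmann]
    congr 1
    ext z
    rw [bargmannIntegrand, mul_comm (conj _)]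
    rfl
  rw [h1, hμ, integral_smul_nnreal_measure, integral_homogeneous_mul_gaussian volume _ (2 * m),
    finrank_real_euclideanSpace, NNReal.smul_def, Complex.real_smul]
  · have : ((2 * m : ℕ) + (2 * Fintype.card ι : ℕ) : ℝ) / 2 = m + Fintype.card ι := by
      push_cast; ring
    rw [this]
    push_cast
    ring
  · intro r hr x
    have : (r • x).ofLp = (r : ℂ) • x.ofLp := by ext i; simp
    rw [this, eval_smul_of_isHomogeneous hp, eval_smul_of_isHomogeneous hq]
    simp only [map_mul, map_pow, Complex.conj_ofReal]
    ring

/-- On the unit sphere, multiplication by a coordinate is adjoint to a multiple of the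
corresponding derivative. -/
lemma sphere_integral_X_mul (i : ι) {m : ℕ} {p q : MvPolynomial ι ℂ}
    (hp : p.IsHomogeneous m) (hq : q.IsHomogeneous (m + 1)) :
    (m + Fintype.card ι : ℂ) * ∫ x : sphere (0 : EuclideanSpace ℂ ι) 1,
        eval x.1.ofLp q * conj (eval x.1.ofLp (X i * p))
        ∂(volume : Measure (EuclideanSpace ℂ ι)).toSphere
      = ∫ x : sphere (0 : EuclideanSpace ℂ ι) 1,
        eval x.1.ofLp (pderiv i q) * conj (eval x.1.ofLp p)
        ∂(volume : Measure (EuclideanSpace ℂ ι)).toSphere := by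
  obtain ⟨c, hc, h⟩ := exists_bargmann_eq_sphere (ι := ι)
  have hXp : (X i * p).IsHomogeneous (m + 1) := by
    rw [add_comm]; exact (isHomogeneous_X ℂ i).mul hp
  have hn : (0 : ℝ) < m + Fintype.card ι := by
    have : 0 < Fintype.card ι := Fintype.card_pos
    positivity
  have h1 := bargmann_X_mul i p q
  rw [h _ _ _ hXp hq, h m _ _ hp (by simpa using hq.pderiv)] at h1
  have h2 : Real.Gamma ((m + 1 : ℕ) + Fintype.card ι)
      = (m + Fintype.card ι) * Real.Gamma (m + Fintype.card ι) := by
    rw [← Real.Gamma_add_one hn.ne']; congr 1; push_cast; ring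
  rw [h2] at h1
  have hG : (Real.Gamma (m + Fintype.card ι) : ℂ) ≠ 0 := by
    exact_mod_cast (Real.Gamma_pos_of_pos hn).ne'
  have hc' : (c : ℂ) ≠ 0 := by exact_mod_cast hc.ne'
  have h3 := mul_left_cancel₀ hc' h1
  push_cast at h3
  refine mul_left_cancel₀ hG ?_
  rw [← h3]
  ring

end SpherePolynomials

section Approximation

open MvPolynomial Metric

/-- The unit sphere of `ℂ^ι`. -/
abbrev USphere (ι : Type) [Fintype ι] : Type := sphere (0 : EuclideanSpace ℂ ι) 1

/-- The surface measure of the unit sphere of `ℂ^ι`. -/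
abbrev surf (ι : Type) [Fintype ι] : Measure (USphere ι) :=
  (volume : Measure (EuclideanSpace ℂ ι)).toSphere

variable {ι : Type} [Fintype ι]

/-- A coordinate function on the unit sphere. -/
def coord (i : ι) : C(USphere ι, ℂ) := ⟨fun x => x.1.ofLp i, by fun_prop⟩

/-- The restriction of polynomials to the unit sphere. -/
def polyMap : MvPolynomial ι ℂ →ₐ[ℂ] C(USphere ι, ℂ) := aeval coord

lemma polyMap_apply (p : MvPolynomial ι ℂ) (x : USphere ι) :
    polyMap p x = eval x.1.ofLp p := by
  induction p using MvPolynomial.induction_on with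
  | C a => simp [polyMap, Algebra.algebraMap_eq_smul_one]
  | add p q hp hq => simp [hp, hq]
  | mul_X p i hp => simp [hp]; left; simp [polyMap, coord]

/-- A continuous function on the sphere as a square-integrable function. -/
abbrev toL2 : C(USphere ι, ℂ) →L[ℂ] Lp ℂ 2 (surf ι) := ContinuousMap.toLp 2 (surf ι) ℂ

lemma inner_toL2 (f g : C(USphere ι, ℂ)) :
    inner ℂ (toL2 f) (toL2 g) = ∫ x, g x * conj (f x) ∂(surf ι) :=
  ContinuousMap.inner_toLp _ f g

lemma norm_toL2_mul_le (f g : C(USphere ι, ℂ)) : ‖toL2 (f * g)‖ ≤ ‖f‖ * ‖toL2 g‖ := by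
  refine Lp.norm_le_mul_norm_of_ae_le_mul ?_
  filter_upwards [ContinuousMap.coeFn_toLp (p := 2) (𝕜 := ℂ) (surf ι) (f * g),
    ContinuousMap.coeFn_toLp (p := 2) (𝕜 := ℂ) (surf ι) g] with x h1 h2
  rw [h1, h2]
  simpa using mul_le_mul_of_nonneg_right (f.norm_coe_le_norm x) (norm_nonneg (g x))

/-- Multiplication by `f` almost maps homogeneous polynomials of high degree to homogeneous
polynomials of high degree. -/
def GradedApprox (f : C(USphere ι, ℂ)) : Prop :=
  ∀ ε : ℝ, 0 < ε → ∀ M : ℕ, ∃ N : ℕ, ∀ m ≥ N, ∀ ψ : MvPolynomial ι ℂ, ψ.IsHomogeneous m →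
    ∃ m' ≥ M, ∃ p : MvPolynomial ι ℂ, p.IsHomogeneous m' ∧
      ‖toL2 (f * polyMap ψ - polyMap p)‖ ≤ ε * ‖toL2 (polyMap ψ)‖

/-- Multiplication by `f` almost maps homogeneous polynomials of high degree to polynomials. -/
def PolyApprox (f : C(USphere ι, ℂ)) : Prop :=
  ∀ ε : ℝ, 0 < ε → ∃ N : ℕ, ∀ m ≥ N, ∀ ψ : MvPolynomial ι ℂ, ψ.IsHomogeneous m →
    ∃ p : MvPolynomial ι ℂ, ‖toL2 (f * polyMap ψ - polyMap p)‖ ≤ ε * ‖toL2 (polyMap ψ)‖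

lemma GradedApprox.polyApprox {f : C(USphere ι, ℂ)} (hf : GradedApprox f) : PolyApprox f := by
  intro ε hε
  obtain ⟨N, hN⟩ := hf ε hε 0
  refine ⟨N, fun m hm ψ hψ => ?_⟩
  obtain ⟨_, _, p, _, hp⟩ := hN m hm ψ hψ
  exact ⟨p, hp⟩

lemma GradedApprox.one : GradedApprox (1 : C(USphere ι, ℂ)) := by
  refine fun ε hε M => ⟨M, fun m hm ψ hψ => ⟨m, hm, ψ, hψ, ?_⟩⟩
  rw [one_mul, sub_self, map_zero, norm_zero]
  positivity

lemma GradedApprox.coord (i : ι) : GradedApprox (coord i) := by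
  refine fun ε hε M => ⟨M, fun m hm ψ hψ =>
    ⟨1 + m, by omega, X i * ψ, (isHomogeneous_X ℂ i).mul hψ, ?_⟩⟩
  rw [map_mul, show polyMap (X i) = GaussianMoments.coord i by simp [polyMap], sub_self, map_zero,
    norm_zero]
  positivity

lemma GradedApprox.mul {f g : C(USphere ι, ℂ)} (hf : GradedApprox f) (hg : GradedApprox g) :
    GradedApprox (f * g) := by
  intro ε hε M
  have hf0 := norm_nonneg f
  have hg0 := norm_nonneg g
  set ε₁ := min 1 (ε / (2 * (‖f‖ + 1))) with h1
  set ε₂ := ε / (2 * (‖g‖ + 1)) with h2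
  have hε₁ : 0 < ε₁ := by positivity
  have hε₂ : 0 < ε₂ := by positivity
  obtain ⟨N, hN⟩ := hf ε₂ hε₂ M
  obtain ⟨N', hN'⟩ := hg ε₁ hε₁ N
  refine ⟨N', fun m hm ψ hψ => ?_⟩
  obtain ⟨k, hk, p, hp, hpψ⟩ := hN' m hm ψ hψ
  obtain ⟨l, hl, r, hr, hrp⟩ := hN k hk p hp
  refine ⟨l, hl, r, hr, ?_⟩
  set a := ‖toL2 (polyMap ψ)‖ with ha
  have ha0 : 0 ≤ a := norm_nonneg _
  have e1 : f * g * polyMap ψ - polyMap r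
      = f * (g * polyMap ψ - polyMap p) + (f * polyMap p - polyMap r) := by ring
  have e2 : polyMap p = g * polyMap ψ - (g * polyMap ψ - polyMap p) := by ring
  have b1 : ‖toL2 (polyMap p)‖ ≤ (‖g‖ + 1) * a := by
    rw [e2, map_sub]
    refine (norm_sub_le _ _).trans ?_
    have := norm_toL2_mul_le g (polyMap ψ)
    have h3 : ε₁ * a ≤ 1 * a := mul_le_mul_of_nonneg_right (min_le_left _ _) ha0
    linarith
  have b2 : ‖f‖ * ‖toL2 (g * polyMap ψ - polyMap p)‖ ≤ ε / 2 * a := by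
    calc _ ≤ (‖f‖ + 1) * (ε / (2 * (‖f‖ + 1)) * a) := by
          gcongr
          · linarith
          · exact hpψ.trans (mul_le_mul_of_nonneg_right (min_le_right _ _) ha0)
      _ = _ := by field_simp
  have b3 : ε₂ * ‖toL2 (polyMap p)‖ ≤ ε / 2 * a := by
    calc _ ≤ ε₂ * ((‖g‖ + 1) * a) := by gcongr
      _ = _ := by rw [h2]; field_simp
  rw [e1, map_add]
  refine (norm_add_le _ _).trans ?_
  have := norm_toL2_mul_le f (g * polyMap ψ - polyMap p)
  linarith

lemma PolyApprox.add {f g : C(USphere ι, ℂ)} (hf : PolyApprox f) (hg : PolyApprox g) :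
    PolyApprox (f + g) := by
  intro ε hε
  obtain ⟨N, hN⟩ := hf (ε / 2) (half_pos hε)
  obtain ⟨N', hN'⟩ := hg (ε / 2) (half_pos hε)
  refine ⟨max N N', fun m hm ψ hψ => ?_⟩
  obtain ⟨p, hp⟩ := hN m ((le_max_left _ _).trans hm) ψ hψ
  obtain ⟨q, hq⟩ := hN' m ((le_max_right _ _).trans hm) ψ hψ
  refine ⟨p + q, ?_⟩
  rw [show (f + g) * polyMap ψ - polyMap (p + q)
    = (f * polyMap ψ - polyMap p) + (g * polyMap ψ - polyMap q) by rw [map_add]; ring, map_add]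
  refine (norm_add_le _ _).trans ?_
  linarith

lemma PolyApprox.zero : PolyApprox (0 : C(USphere ι, ℂ)) := by
  refine fun ε hε => ⟨0, fun m _ ψ _ => ⟨0, ?_⟩⟩
  rw [zero_mul, map_zero, sub_self, map_zero, norm_zero]
  positivity

lemma PolyApprox.smul {f : C(USphere ι, ℂ)} (hf : PolyApprox f) (c : ℂ) : PolyApprox (c • f) := by
  intro ε hε
  have hc := norm_nonneg c
  obtain ⟨N, hN⟩ := hf (ε / (‖c‖ + 1)) (by positivity)
  refine ⟨N, fun m hm ψ hψ => ?_⟩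
  obtain ⟨p, hp⟩ := hN m hm ψ hψ
  refine ⟨c • p, ?_⟩
  have e : c • f * polyMap ψ - polyMap (c • p) = c • (f * polyMap ψ - polyMap p) := by
    ext x
    simp [mul_sub, mul_assoc]
  rw [e, map_smul, norm_smul]
  calc _ ≤ (‖c‖ + 1) * (ε / (‖c‖ + 1) * ‖toL2 (polyMap ψ)‖) := by
        gcongr
        linarith
    _ = _ := by field_simp

lemma isClosed_polyApprox : IsClosed {f : C(USphere ι, ℂ) | PolyApprox f} := by
  refine isClosed_of_closure_subset fun f hf ε hε => ?_
  obtain ⟨g, hg, hfg⟩ := Metric.mem_closure_iff.1 hf (ε / 2) (half_pos hε)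
  obtain ⟨N, hN⟩ := hg (ε / 2) (half_pos hε)
  refine ⟨N, fun m hm ψ hψ => ?_⟩
  obtain ⟨p, hp⟩ := hN m hm ψ hψ
  refine ⟨p, ?_⟩
  rw [show f * polyMap ψ - polyMap p = (f - g) * polyMap ψ + (g * polyMap ψ - polyMap p) by ring,
    map_add]
  refine (norm_add_le _ _).trans ?_
  have h1 := norm_toL2_mul_le (f - g) (polyMap ψ)
  have h2 : ‖f - g‖ * ‖toL2 (polyMap ψ)‖ ≤ ε / 2 * ‖toL2 (polyMap ψ)‖ := by
    gcongr
    rw [← dist_eq_norm]; exact hfg.le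
  linarith

lemma norm_toL2_sq (f : C(USphere ι, ℂ)) :
    ‖toL2 f‖ ^ 2 = ∫ x, ‖f x‖ ^ 2 ∂(surf ι) := by
  have h := inner_toL2 f f
  rw [inner_self_eq_norm_sq_to_K] at h
  simp_rw [Complex.mul_conj'] at h
  apply Complex.ofReal_injective
  rw [← integral_complex_ofReal]
  simpa using h

lemma sum_norm_sq_star_coord_mul (f : C(USphere ι, ℂ)) :
    ∑ i, ‖toL2 (star (coord i) * f)‖ ^ 2 = ‖toL2 f‖ ^ 2 := by
  simp_rw [norm_toL2_sq]
  rw [← integral_finsetSum]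
  · congr 1
    ext x
    have hx : ‖x.1‖ ^ 2 = 1 := by simp
    rw [EuclideanSpace.norm_sq_eq] at hx
    simp only [ContinuousMap.mul_apply, ContinuousMap.star_apply, norm_mul, _root_.norm_star,
      mul_pow, GaussianMoments.coord, ContinuousMap.coe_mk]
    rw [← Finset.sum_mul, hx, one_mul]
  · intro i _
    exact Continuous.integrable_of_hasCompactSupport (by fun_prop)
      (HasCompactSupport.of_compactSpace _)

variable [Nonempty ι]

lemma inner_coord_mul (i : ι) {m : ℕ} {p q : MvPolynomial ι ℂ}
    (hp : p.IsHomogeneous m) (hq : q.IsHomogeneous (m + 1)) :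
    (m + Fintype.card ι : ℂ) * inner ℂ (toL2 (polyMap p)) (toL2 (star (coord i) * polyMap q))
      = inner ℂ (toL2 (polyMap p)) (toL2 (polyMap (pderiv i q))) := by
  rw [inner_toL2, inner_toL2]
  simp only [polyMap_apply]
  rw [← sphere_integral_X_mul i hp hq]
  congr 2
  ext x
  simp [polyMap_apply, GaussianMoments.coord]
  ring

lemma norm_sq_star_coord_mul_sub (i : ι) {m : ℕ} {q : MvPolynomial ι ℂ}
    (hq : q.IsHomogeneous (m + 1)) :
    ‖toL2 (star (coord i) * polyMap q
        - polyMap (((m + Fintype.card ι : ℂ)⁻¹) • pderiv i q))‖ ^ 2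
      = ‖toL2 (star (coord i) * polyMap q)‖ ^ 2
        - (m + Fintype.card ι : ℝ)⁻¹ ^ 2 * ‖toL2 (polyMap (pderiv i q))‖ ^ 2 := by
  have hn : (0 : ℝ) < m + Fintype.card ι := by
    have : 0 < Fintype.card ι := Fintype.card_pos
    positivity
  have hn' : (m + Fintype.card ι : ℂ) ≠ 0 := by exact_mod_cast hn.ne'
  have h := inner_coord_mul i (by simpa using hq.pderiv (i := i)) hq
  set u := toL2 (star (coord i) * polyMap q)
  set v := toL2 (polyMap (pderiv i q))
  have h' : inner ℂ v u = (m + Fintype.card ι : ℂ)⁻¹ * inner ℂ v v := by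
    rw [← h]; field_simp
  have hre : RCLike.re (inner ℂ u v) = (m + Fintype.card ι : ℝ)⁻¹ * ‖v‖ ^ 2 := by
    rw [inner_re_symm, h', inner_self_eq_norm_sq_to_K]
    have : (m + Fintype.card ι : ℂ)⁻¹ * ((‖v‖ : ℂ)) ^ 2
      = (((m + Fintype.card ι : ℝ)⁻¹ * ‖v‖ ^ 2 : ℝ) : ℂ) := by push_cast; rfl
    erw [this]
    exact Complex.ofReal_re _
  rw [map_smul, map_sub, map_smul, @norm_sub_sq ℂ, inner_smul_right, norm_smul]
  have h2 : RCLike.re ((m + Fintype.card ι : ℂ)⁻¹ * inner ℂ u v)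
      = (m + Fintype.card ι : ℝ)⁻¹ * RCLike.re (inner ℂ u v) := by
    have : (m + Fintype.card ι : ℂ)⁻¹ = (((m + Fintype.card ι : ℝ)⁻¹ : ℝ) : ℂ) := by push_cast; rfl
    rw [this]
    exact Complex.re_ofReal_mul _ _
  have h3 : ‖(m + Fintype.card ι : ℂ)⁻¹‖ = (m + Fintype.card ι : ℝ)⁻¹ := by
    rw [norm_inv]
    congr 1
    have : (m + Fintype.card ι : ℂ) = ((m + Fintype.card ι : ℝ) : ℂ) := by push_cast; rfl
    rw [this, Complex.norm_real, Real.norm_of_nonneg hn.le]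
  rw [h2, hre, h3]
  ring

lemma sum_norm_sq_pderiv {m : ℕ} {q : MvPolynomial ι ℂ} (hq : q.IsHomogeneous (m + 1)) :
    ∑ i, ‖toL2 (polyMap (pderiv i q))‖ ^ 2
      = (m + Fintype.card ι) * (m + 1) * ‖toL2 (polyMap q)‖ ^ 2 := by
  have h : ∀ i : ι, (‖toL2 (polyMap (pderiv i q))‖ ^ 2 : ℂ)
      = (m + Fintype.card ι) *
        inner ℂ (toL2 (polyMap (X i * pderiv i q))) (toL2 (polyMap q)) := by
    intro i
    have h1 := sphere_integral_X_mul i (p := pderiv i q) (by simpa using hq.pderiv (i := i)) hq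
    rw [inner_toL2]
    simp only [polyMap_apply]
    rw [h1]
    have h2 := inner_self_eq_norm_sq_to_K (𝕜 := ℂ) (toL2 (polyMap (pderiv i q)))
    rw [inner_toL2] at h2
    simp only [polyMap_apply] at h2
    rw [h2]
    rfl
  apply Complex.ofReal_injective
  push_cast
  rw [Finset.sum_congr rfl fun i _ => h i, ← Finset.mul_sum, ← sum_inner, ← map_sum, ← map_sum,
    hq.sum_X_mul_pderiv, map_nsmul, map_nsmul, ← Nat.cast_smul_eq_nsmul ℂ, inner_smul_left,
    inner_self_eq_norm_sq_to_K]
  simp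
  ring

lemma GradedApprox.star_coord (i : ι) : GradedApprox (star (GaussianMoments.coord i)) := by
  intro ε hε M
  obtain ⟨N, hN⟩ := exists_nat_gt (Fintype.card ι / ε ^ 2)
  refine ⟨max N M + 1, fun k hk ψ hψ => ?_⟩
  obtain ⟨m, rfl⟩ : ∃ m, k = m + 1 := ⟨k - 1, by omega⟩
  have hm : N ≤ m := by omega
  have hn1 : 0 < Fintype.card ι := Fintype.card_pos
  have hn : (0 : ℝ) < m + Fintype.card ι := by positivity
  refine ⟨m, by omega, ((m + Fintype.card ι : ℂ)⁻¹) • pderiv i ψ, ?_, ?_⟩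
  · exact (homogeneousSubmodule ι ℂ m).smul_mem _ (by simpa using hψ.pderiv (i := i))
  set D : ι → ℝ := fun i => ‖toL2 (star (GaussianMoments.coord i) * polyMap ψ
        - polyMap (((m + Fintype.card ι : ℂ)⁻¹) • pderiv i ψ))‖ ^ 2
  have h1 : ∑ i, D i = (Fintype.card ι - 1) / (m + Fintype.card ι) * ‖toL2 (polyMap ψ)‖ ^ 2 := by
    simp only [D]
    rw [Finset.sum_congr rfl fun i _ => norm_sq_star_coord_mul_sub i hψ, Finset.sum_sub_distrib,
      sum_norm_sq_star_coord_mul, ← Finset.mul_sum, sum_norm_sq_pderiv hψ]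
    field_simp
    ring
  have h2 : D i ≤ ∑ i, D i :=
    Finset.single_le_sum (f := D) (fun i _ => sq_nonneg _) (Finset.mem_univ i)
  have h3 : ((Fintype.card ι - 1) / (m + Fintype.card ι) : ℝ) ≤ ε ^ 2 := by
    rw [div_le_iff₀ hn]
    rw [div_lt_iff₀ (by positivity)] at hN
    have : (N : ℝ) ≤ m := by exact_mod_cast hm
    nlinarith [sq_nonneg ε, mul_le_mul_of_nonneg_left this (sq_nonneg ε),
      mul_nonneg (sq_nonneg ε) (Nat.cast_nonneg (α := ℝ) (Fintype.card ι))]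
  refine le_of_sq_le_sq ?_ (by positivity)
  rw [mul_pow]
  calc _ ≤ _ := h2
    _ ≤ _ := by rw [h1]; gcongr

/-- Every continuous function on the sphere almost maps homogeneous polynomials of high degree
to polynomials. -/
theorem polyApprox (f : C(USphere ι, ℂ)) : PolyApprox f := by
  let s : Set C(USphere ι, ℂ) := Set.range coord
  let A : StarSubalgebra ℂ C(USphere ι, ℂ) := StarAlgebra.adjoin ℂ s
  have hsep : A.SeparatesPoints := by
    intro x y hxy
    obtain ⟨i, hi⟩ : ∃ i, x.1.ofLp i ≠ y.1.ofLp i := by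
      by_contra! h
      exact hxy (Subtype.ext (PiLp.ext h))
    exact ⟨_, ⟨coord i, StarAlgebra.subset_adjoin ℂ s ⟨i, rfl⟩, rfl⟩, hi⟩
  have htop := ContinuousMap.starSubalgebra_topologicalClosure_eq_top_of_separatesPoints A hsep
  have hA : ∀ g ∈ A, PolyApprox g := by
    intro g hg
    have hg' : g ∈ Submodule.span ℂ (Submonoid.closure (s ∪ star s) : Set C(USphere ι, ℂ)) := by
      rw [← Algebra.adjoin_eq_span]
      exact hg
    clear hg
    induction hg' using Submodule.span_induction with
    | mem x hx =>
      refine GradedApprox.polyApprox ?_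
      induction hx using Submonoid.closure_induction with
      | mem x hx =>
        rcases hx with ⟨i, rfl⟩ | hx
        · exact .coord i
        · obtain ⟨i, hi⟩ := hx
          rw [← star_star x, ← hi]
          exact .star_coord i
      | one => exact .one
      | mul x y _ _ hx hy => exact hx.mul hy
    | zero => exact .zero
    | add x y _ _ hx hy => exact hx.add hy
    | smul c x _ hx => exact hx.smul c
  have hf : f ∈ A.topologicalClosure := by rw [htop]; trivial
  exact closure_minimal hA isClosed_polyApprox hf

end Approximation

section SkewForms

open Module Matrix

lemma exists_ne_zero_of_skew {V : Type} [AddCommGroup V] [Module ℂ V] [FiniteDimensional ℂ V]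
    (B : V →ₗ[ℂ] V →ₗ[ℂ] ℂ) (hB : ∀ v w, B v w = -B w v) (h : Odd (finrank ℂ V)) :
    ∃ v ≠ 0, ∀ w, B w v = 0 := by
  let b := finBasis ℂ V
  let M : Matrix (Fin (finrank ℂ V)) (Fin (finrank ℂ V)) ℂ := fun i j => B (b i) (b j)
  have hM : Mᵀ = -M := by
    ext i j
    exact hB _ _
  have hdet : M.det = 0 := by
    have h1 : M.det = -M.det := by
      conv_lhs => rw [← det_transpose, hM, det_neg, Fintype.card_fin, h.neg_one_pow, neg_one_mul]
    exact self_eq_neg.1 h1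
  obtain ⟨c, hc, hMc⟩ := exists_mulVec_eq_zero_iff.2 hdet
  refine ⟨b.equivFun.symm c, (LinearEquiv.map_ne_zero_iff _).2 hc, fun w => ?_⟩
  have : B.flip (b.equivFun.symm c) = 0 := by
    refine b.ext fun i => ?_
    have := congrFun hMc i
    simp only [mulVec, dotProduct, M, Pi.zero_apply] at this
    rw [LinearMap.flip_apply, Basis.equivFun_symm_apply, map_sum, LinearMap.zero_apply, ← this]
    simp only [map_smul, smul_eq_mul]
    exact Finset.sum_congr rfl fun j _ => mul_comm _ _
  exact LinearMap.congr_fun this w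

end SkewForms

section Dimension

open MvPolynomial Module

variable (ι : Type) [Fintype ι]

lemma finrank_homogeneousSubmodule (m : ℕ) :
    finrank ℂ (homogeneousSubmodule ι ℂ m) = (Fintype.card ι + m - 1).choose m := by
  classical
  have hset : {d : ι →₀ ℕ | d.degree = m} = (Finset.univ.finsuppAntidiag m : Finset (ι →₀ ℕ)) := by
    ext d
    simp [Finsupp.degree_eq_sum]
  rw [homogeneousSubmodule_eq_finsupp_supported, hset,
    (AddMonoidAlgebra.supportedEquivFinsupp _).finrank_eq, finrank_finsupp_self]
  simp only [Finset.coe_sort_coe, Fintype.card_coe]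
  rw [Finset.card_finsuppAntidiag_nat_eq_choose, Finset.card_univ]

instance (m : ℕ) : FiniteDimensional ℂ (homogeneousSubmodule ι ℂ m) :=
  Module.Finite.iff_fg.2 (homogeneousSubmodule_fg ι ℂ m)

end Dimension

lemma odd_choose_five (t : ℕ) : Odd ((8 * t + 15).choose 5) := by
  have : Fact (Nat.Prime 2) := ⟨Nat.prime_two⟩
  have h1 := Choose.choose_modEq_choose_mod_mul_choose_div_nat (n := 8 * t + 15) (k := 5) (p := 2)
  have h2 := Choose.choose_modEq_choose_mod_mul_choose_div_nat (n := 4 * t + 7) (k := 2) (p := 2)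
  rw [show (8 * t + 15) % 2 = 1 by omega, show (8 * t + 15) / 2 = 4 * t + 7 by omega] at h1
  rw [show (4 * t + 7) % 2 = 1 by omega, show (4 * t + 7) / 2 = 2 * t + 3 by omega] at h2
  norm_num [Nat.ModEq] at h1 h2
  rw [Nat.odd_iff]
  omega

lemma even_choose_five (t : ℕ) : Even ((8 * t + 11).choose 5) := by
  have : Fact (Nat.Prime 2) := ⟨Nat.prime_two⟩
  have h1 := Choose.choose_modEq_choose_mod_mul_choose_div_nat (n := 8 * t + 11) (k := 5) (p := 2)
  have h2 := Choose.choose_modEq_choose_mod_mul_choose_div_nat (n := 4 * t + 5) (k := 2) (p := 2)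
  rw [show (8 * t + 11) % 2 = 1 by omega, show (8 * t + 11) / 2 = 4 * t + 5 by omega] at h1
  rw [show (4 * t + 5) % 2 = 1 by omega, show (4 * t + 5) / 2 = 2 * t + 2 by omega] at h2
  norm_num [Nat.ModEq] at h1 h2
  rw [Nat.even_iff]
  omega

section Symmetries

open MvPolynomial Metric Module

variable {ι : Type} [Fintype ι]

/-- Multiplication by a unit complex number, as an isometry. -/
def rotIsometry (u : ℂ) (hu : ‖u‖ = 1) : EuclideanSpace ℂ ι ≃ₗᵢ[ℝ] EuclideanSpace ℂ ι :=
  LinearIsometry.toLinearIsometryEquiv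
    { toFun := fun z => u • z
      map_add' := fun _ _ => smul_add _ _ _
      map_smul' := fun _ _ => smul_comm _ _ _
      norm_map' := fun z => by
        change ‖u • z‖ = ‖z‖
        rw [norm_smul, hu, one_mul] } rfl

/-- Multiplication by a unit complex number on the sphere. -/
def rot (u : ℂ) (hu : ‖u‖ = 1) : USphere ι → USphere ι := sphereMap (rotIsometry u hu)

lemma rot_ofLp (u : ℂ) (hu : ‖u‖ = 1) (x : USphere ι) :
    (rot u hu x).1.ofLp = u • x.1.ofLp := rfl

lemma integral_comp_rot [Nonempty ι] (u : ℂ) (hu : ‖u‖ = 1) (F : USphere ι → ℂ) :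
    ∫ x, F (rot u hu x) ∂(surf ι) = ∫ x, F x ∂(surf ι) :=
  integral_comp_sphereMap _ F

variable {κ : Type} [Fintype κ]

/-- The quaternionic structure of `ℂ^(κ ⊕ κ)`, as an isometry. -/
def quatIsometry : EuclideanSpace ℂ (κ ⊕ κ) ≃ₗᵢ[ℝ] EuclideanSpace ℂ (κ ⊕ κ) :=
  LinearIsometry.toLinearIsometryEquiv
    { toFun := fun z => WithLp.toLp 2
        (Sum.elim (fun k => -conj (z (Sum.inr k))) (fun k => conj (z (Sum.inl k))))
      map_add' := fun z z' => by
        ext (k | k)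
        · simp; ring
        · simp
      map_smul' := fun c z => by
        ext (k | k) <;> simp
      norm_map' := fun z => by
        change ‖WithLp.toLp 2 _‖ = ‖z‖
        rw [EuclideanSpace.norm_eq, EuclideanSpace.norm_eq]
        simp [add_comm] } rfl

/-- The quaternionic structure on the sphere. -/
def quat : C(USphere (κ ⊕ κ), USphere (κ ⊕ κ)) :=
  ⟨sphereMap quatIsometry, continuous_sphereMap _⟩

lemma quat_ofLp (x : USphere (κ ⊕ κ)) :
    (quat x).1.ofLp = Sum.elim (fun k => -conj (x.1.ofLp (Sum.inr k)))
      (fun k => conj (x.1.ofLp (Sum.inl k))) := rfl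

lemma quat_quat_ofLp (x : USphere (κ ⊕ κ)) : (quat (quat x)).1.ofLp = (-1 : ℂ) • x.1.ofLp := by
  ext (k | k) <;> simp [quat_ofLp]

lemma integral_comp_quat [Nonempty κ] (F : USphere (κ ⊕ κ) → ℂ) :
    ∫ x, F (quat x) ∂(surf (κ ⊕ κ)) = ∫ x, F x ∂(surf (κ ⊕ κ)) :=
  integral_comp_sphereMap _ F

lemma exists_polyMap_quat {m : ℕ} {p : MvPolynomial (κ ⊕ κ) ℂ} (hp : p.IsHomogeneous m) :
    ∃ q : MvPolynomial (κ ⊕ κ) ℂ, q.IsHomogeneous m ∧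
      ∀ x, polyMap q (quat x) = conj (polyMap p x) := by
  let y : κ ⊕ κ → MvPolynomial (κ ⊕ κ) ℂ :=
    Sum.elim (fun k => X (Sum.inr k)) (fun k => -X (Sum.inl k))
  refine ⟨aeval y (map (starRingEnd ℂ) p), ?_, fun x => ?_⟩
  · have := (hp.map (starRingEnd ℂ)).aeval y (n := 1) (by
      rintro (k | k)
      · exact isHomogeneous_X _ _
      · exact (isHomogeneous_X _ _).neg)
    simpa using this
  · rw [polyMap_apply, polyMap_apply]
    clear hp
    induction p using MvPolynomial.induction_on with
    | C a => simp [algebraMap_eq]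
    | add p q hp hq => simp only [map_add, hp, hq]
    | mul_X p i hp =>
      simp only [map_mul, hp, map_X, aeval_X, eval_X]
      congr 1
      rcases i with k | k <;> simp [y, quat_ofLp]

end Symmetries

section Degeneracy

open MvPolynomial Metric Module

variable {ι : Type} [Fintype ι]

lemma toL2_polyMap_ne_zero [Nonempty ι] {m : ℕ} {p : MvPolynomial ι ℂ}
    (hp : p.IsHomogeneous m) (h0 : p ≠ 0) :
    toL2 (polyMap p) ≠ 0 := by
  intro h
  apply h0
  have h1 : polyMap p = 0 := ContinuousMap.toLp_injective (surf ι) (by rw [h, map_zero])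
  have h2 : ∀ z : EuclideanSpace ℂ ι, z ≠ 0 → eval z.ofLp p = 0 := by
    intro z hz
    have hz' : ‖z‖ ≠ 0 := norm_ne_zero_iff.2 hz
    let x : USphere ι := ⟨(‖z‖⁻¹ : ℂ) • z, by simp [norm_smul, hz']⟩
    have hx : z.ofLp = (‖z‖ : ℂ) • x.1.ofLp := by
      have : (‖z‖ : ℂ) ≠ 0 := by exact_mod_cast hz'
      ext i
      simp [x, this]
    rw [hx, eval_smul_of_isHomogeneous hp, ← polyMap_apply, h1]
    simp
  refine MvPolynomial.funext fun y => ?_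
  rw [map_zero]
  by_cases hy : y = 0
  · obtain ⟨z, hz⟩ := exists_ne (0 : EuclideanSpace ℂ ι)
    have := eval_smul_of_isHomogeneous hp 0 z.ofLp
    rw [h2 z hz, mul_zero, zero_smul] at this
    rw [hy, this]
  · exact h2 (WithLp.toLp 2 y) (by simpa using hy)

/-- The integral over the sphere, as a linear functional. -/
def integralSphere : C(USphere ι, ℂ) →ₗ[ℂ] ℂ :=
  (innerSL ℂ (toL2 1) ∘L toL2 : C(USphere ι, ℂ) →L[ℂ] ℂ).toLinearMap

lemma integralSphere_apply (f : C(USphere ι, ℂ)) : integralSphere f = ∫ x, f x ∂(surf ι) := by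
  refine (inner_toL2 1 f).trans ?_
  simp

lemma inner_eq_zero_of_degree_ne [Nonempty ι] {a b : ℕ} (hab : a ≠ b) {p : MvPolynomial ι ℂ}
    (hp : p.IsHomogeneous a) {f : C(USphere ι, ℂ)}
    (hf : ∀ (u : ℂ) (hu : ‖u‖ = 1) (x : USphere ι), f (rot u hu x) = u ^ b * f x) :
    inner ℂ (toL2 (polyMap p)) (toL2 f) = 0 := by
  obtain ⟨u, hu, hu'⟩ := exists_unit_pow_ne hab
  rw [inner_toL2]
  have h := integral_comp_rot u hu (fun x : USphere ι => f x * conj (polyMap p x))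
  have h1 : ∀ x : USphere ι, f (rot u hu x) * conj (polyMap p (rot u hu x))
      = -(f x * conj (polyMap p x)) := by
    intro x
    rw [hf, polyMap_apply, rot_ofLp, eval_smul_of_isHomogeneous hp, ← polyMap_apply, map_mul,
      map_pow]
    linear_combination (f x * conj (polyMap p x)) * hu'
  simp only [h1] at h
  rw [integral_neg] at h
  exact self_eq_neg.1 h.symm

lemma inner_polyMap_eq_zero {f : C(USphere ι, ℂ)}
    (h : ∀ a, ∀ p : MvPolynomial ι ℂ, p.IsHomogeneous a →
      inner ℂ (toL2 (polyMap p)) (toL2 f) = 0) (p : MvPolynomial ι ℂ) :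
    inner ℂ (toL2 (polyMap p)) (toL2 f) = 0 := by
  rw [← sum_homogeneousComponent p, map_sum, map_sum, sum_inner]
  exact Finset.sum_eq_zero fun a _ => h a _ (homogeneousComponent_isHomogeneous a p)

variable {κ : Type} [Fintype κ] {α : Type} [Fintype α]

/-- The integrand of the pairing attached to a matrix of functions on the sphere. -/
def pairing (N : α → α → C(USphere (κ ⊕ κ), ℂ)) (φ ψ : α → MvPolynomial (κ ⊕ κ) ℂ) :
    C(USphere (κ ⊕ κ), ℂ) :=
  ∑ i, ∑ k, (polyMap (φ i)).comp quat * N i k * polyMap (ψ k)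

/-- The bilinear form attached to a matrix of functions on the sphere. -/
def pairingForm (N : α → α → C(USphere (κ ⊕ κ), ℂ)) :
    (α → MvPolynomial (κ ⊕ κ) ℂ) →ₗ[ℂ] (α → MvPolynomial (κ ⊕ κ) ℂ) →ₗ[ℂ] ℂ :=
  LinearMap.mk₂ ℂ (fun φ ψ => integralSphere (pairing N φ ψ))
    (fun φ φ' ψ => by
      rw [← map_add]; congr 1; ext x
      simp [pairing, add_mul, Finset.sum_add_distrib])
    (fun c φ ψ => by
      rw [← map_smul]; congr 1; ext x
      simp [pairing, mul_assoc, Finset.mul_sum])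
    (fun φ ψ ψ' => by
      rw [← map_add]; congr 1; ext x
      simp [pairing, mul_add, Finset.sum_add_distrib])
    (fun c φ ψ => by
      rw [← map_smul]; congr 1; ext x
      simp only [pairing, ContinuousMap.sum_apply, ContinuousMap.mul_apply, Pi.smul_apply,
        map_smul, ContinuousMap.smul_apply, smul_eq_mul, Finset.mul_sum]
      exact Finset.sum_congr rfl fun i _ => Finset.sum_congr rfl fun k _ => by ring)

lemma pairingForm_apply (N : α → α → C(USphere (κ ⊕ κ), ℂ))
    (φ ψ : α → MvPolynomial (κ ⊕ κ) ℂ) :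
    pairingForm N φ ψ = ∫ x, pairing N φ ψ x ∂(surf (κ ⊕ κ)) :=
  integralSphere_apply _

variable [Nonempty κ]

lemma exists_orthogonal_of_odd (N : α → α → C(USphere (κ ⊕ κ), ℂ)) (m : α → ℕ)
    (hm : ∀ k, Even (m k)) (hodd : Odd (∑ k, finrank ℂ (homogeneousSubmodule (κ ⊕ κ) ℂ (m k))))
    (hN : ∀ i k x, N i k (quat x) = -N k i x) :
    ∃ ψ : α → MvPolynomial (κ ⊕ κ) ℂ, (∀ k, (ψ k).IsHomogeneous (m k)) ∧ ψ ≠ 0 ∧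
      ∀ i, ∀ p : MvPolynomial (κ ⊕ κ) ℂ, p.IsHomogeneous (m i) →
        inner ℂ (toL2 (polyMap p)) (toL2 (∑ k, N i k * polyMap (ψ k))) = 0 := by
  classical
  let V := ∀ k, homogeneousSubmodule (κ ⊕ κ) ℂ (m k)
  let incl : V →ₗ[ℂ] (α → MvPolynomial (κ ⊕ κ) ℂ) :=
    LinearMap.pi fun k => (homogeneousSubmodule (κ ⊕ κ) ℂ (m k)).subtype ∘ₗ LinearMap.proj k
  let B : V →ₗ[ℂ] V →ₗ[ℂ] ℂ := (pairingForm N).compl₁₂ incl incl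
  have hBapp : ∀ φ ψ : V, B φ ψ
      = ∫ x, pairing N (fun k => (φ k).1) (fun k => (ψ k).1) x ∂(surf (κ ⊕ κ)) :=
    fun φ ψ => pairingForm_apply N _ _
  have hB : ∀ φ ψ : V, B φ ψ = -B ψ φ := by
    intro φ ψ
    rw [hBapp, hBapp, ← integral_neg, ← integral_comp_quat]
    congr 1
    ext x
    simp only [pairing, ContinuousMap.sum_apply, ContinuousMap.mul_apply, ContinuousMap.comp_apply]
    rw [Finset.sum_comm, ← Finset.sum_neg_distrib]
    refine Finset.sum_congr rfl fun i _ => ?_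
    rw [← Finset.sum_neg_distrib]
    refine Finset.sum_congr rfl fun k _ => ?_
    rw [hN, polyMap_apply, quat_quat_ofLp, eval_smul_of_isHomogeneous (φ k).2, (hm k).neg_one_pow,
      ← polyMap_apply]
    ring
  obtain ⟨ψ, hψ, h⟩ := exists_ne_zero_of_skew B hB (by rwa [finrank_pi_fintype])
  refine ⟨fun k => (ψ k).1, fun k => (ψ k).2, fun h0 => hψ ?_, fun i p hp => ?_⟩
  · ext1 k
    exact Subtype.ext (congrFun h0 k)
  · obtain ⟨q, hq, hqp⟩ := exists_polyMap_quat hp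
    have := h (Pi.single i ⟨q, (mem_homogeneousSubmodule _ _).2 hq⟩)
    rw [hBapp] at this
    rw [inner_toL2, ← this]
    congr 1
    ext x
    simp only [pairing, ContinuousMap.sum_apply, ContinuousMap.mul_apply, ContinuousMap.comp_apply]
    symm
    rw [Finset.sum_eq_single i, Finset.sum_mul]
    · simp only [Pi.single_eq_same, hqp]
      exact Finset.sum_congr rfl fun k _ => by ring
    · intro j _ hj
      simp [Pi.single_eq_of_ne hj]
    · simp

/-- A nondegenerate matrix of functions on the sphere cannot be skew-symmetric with respect to
the quaternionic structure if the corresponding spaces of homogeneous polynomials have odd total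
dimension in arbitrarily high degrees. -/
theorem not_skew_of_odd (N : α → α → C(USphere (κ ⊕ κ), ℂ)) (w : α → ℕ) (hw : ∀ k, Even (w k))
    (hodd : ∀ M, ∃ D ≥ M, Even D ∧
      Odd (∑ k, finrank ℂ (homogeneousSubmodule (κ ⊕ κ) ℂ (D + w k))))
    (hN : ∀ i k x, N i k (quat x) = -N k i x)
    (hrot : ∀ (u : ℂ) (hu : ‖u‖ = 1) (x) (i k), u ^ w k * N i k (rot u hu x) = u ^ w i * N i k x)
    {δ : ℝ} (hδ : 0 < δ)
    (hbound : ∀ x (c : α → ℂ), δ * ∑ k, ‖c k‖ ^ 2 ≤ ∑ i, ‖∑ k, N i k x * c k‖ ^ 2) : False := by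
  classical
  set n := (Fintype.card α : ℝ) with hn
  have hn0 : 0 ≤ n := Nat.cast_nonneg _
  obtain ⟨ε, hε, hεδ⟩ : ∃ ε : ℝ, 0 < ε ∧ n * (ε ^ 2 * n) < δ := by
    refine ⟨Real.sqrt (δ / (2 * (n ^ 2 + 1))), by positivity, ?_⟩
    rw [Real.sq_sqrt (by positivity)]
    field_simp
    nlinarith [sq_nonneg n]
  have happ : ∀ i k, ∃ M : ℕ, ∀ m ≥ M, ∀ ψ : MvPolynomial (κ ⊕ κ) ℂ, ψ.IsHomogeneous m →
      ∃ p : MvPolynomial (κ ⊕ κ) ℂ,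
        ‖toL2 (N i k * polyMap ψ - polyMap p)‖ ≤ ε * ‖toL2 (polyMap ψ)‖ :=
    fun i k => polyApprox (N i k) ε hε
  choose M hM using happ
  obtain ⟨D, hD, hDe, hDo⟩ := hodd (∑ i, ∑ k, M i k)
  obtain ⟨ψ, hψ, hψ0, horth⟩ := exists_orthogonal_of_odd N (fun k => D + w k)
    (fun k => hDe.add (hw k)) hDo hN
  set f : α → C(USphere (κ ⊕ κ), ℂ) := fun i => ∑ k, N i k * polyMap (ψ k) with hf
  set S := ∑ k, ‖toL2 (polyMap (ψ k))‖ ^ 2 with hS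
  have hSpos : 0 < S := by
    obtain ⟨k, hk⟩ := Function.ne_iff.1 hψ0
    have h1 : 0 < ‖toL2 (polyMap (ψ k))‖ := norm_pos_iff.2 (toL2_polyMap_ne_zero (hψ k) hk)
    exact lt_of_lt_of_le (by positivity)
      (Finset.single_le_sum (f := fun k => ‖toL2 (polyMap (ψ k))‖ ^ 2)
        (fun _ _ => sq_nonneg _) (Finset.mem_univ k))
  have hfrot : ∀ i (u : ℂ) (hu : ‖u‖ = 1) x, f i (rot u hu x) = u ^ (D + w i) * f i x := by
    intro i u hu x
    simp only [hf, ContinuousMap.sum_apply, ContinuousMap.mul_apply, Finset.mul_sum]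
    refine Finset.sum_congr rfl fun k _ => ?_
    rw [polyMap_apply, rot_ofLp, eval_smul_of_isHomogeneous (hψ k), ← polyMap_apply, pow_add,
      pow_add]
    linear_combination u ^ D * polyMap (ψ k) x * hrot u hu x i k
  have hforth : ∀ i p, inner ℂ (toL2 (polyMap p)) (toL2 (f i)) = 0 := by
    intro i
    refine inner_polyMap_eq_zero fun a p hp => ?_
    by_cases ha : a = D + w i
    · subst ha
      exact horth i p hp
    · exact inner_eq_zero_of_degree_ne ha hp (hfrot i)
  have hfle : ∀ i, ‖toL2 (f i)‖ ≤ ε * ∑ k, ‖toL2 (polyMap (ψ k))‖ := by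
    intro i
    have h1 : ∀ k, ∃ p : MvPolynomial (κ ⊕ κ) ℂ,
        ‖toL2 (N i k * polyMap (ψ k) - polyMap p)‖ ≤ ε * ‖toL2 (polyMap (ψ k))‖ := by
      intro k
      refine hM i k _ ?_ _ (hψ k)
      have h2 : M i k ≤ ∑ k, M i k :=
        Finset.single_le_sum (f := fun k => M i k) (fun _ _ => Nat.zero_le _) (Finset.mem_univ k)
      have h3 : ∑ k, M i k ≤ ∑ i, ∑ k, M i k :=
        Finset.single_le_sum (f := fun i => ∑ k, M i k) (fun _ _ => Nat.zero_le _)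
          (Finset.mem_univ i)
      omega
    choose p hp using h1
    have h2 : ‖toL2 (f i - polyMap (∑ k, p k))‖ ≤ ε * ∑ k, ‖toL2 (polyMap (ψ k))‖ := by
      rw [hf, map_sum, ← Finset.sum_sub_distrib, map_sum, Finset.mul_sum]
      exact (norm_sum_le _ _).trans (Finset.sum_le_sum fun k _ => hp k)
    refine le_trans ?_ h2
    have h3 : inner ℂ (toL2 (f i)) (toL2 (f i - polyMap (∑ k, p k))) = (‖toL2 (f i)‖ : ℂ) ^ 2 := by
      rw [map_sub, inner_sub_right, inner_eq_zero_symm.1 (hforth i _), sub_zero,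
        inner_self_eq_norm_sq_to_K]
      rfl
    have h4 := norm_inner_le_norm (𝕜 := ℂ) (toL2 (f i)) (toL2 (f i - polyMap (∑ k, p k)))
    rw [h3, norm_pow, Complex.norm_real, norm_norm, sq] at h4
    rcases (norm_nonneg (toL2 (f i))).eq_or_lt with h5 | h5
    · rw [← h5]; positivity
    · exact le_of_mul_le_mul_left h4 h5
  have hgi : ∀ g : C(USphere (κ ⊕ κ), ℂ), Integrable (fun x => ‖g x‖ ^ 2) (surf (κ ⊕ κ)) :=
    fun g => Continuous.integrable_of_hasCompactSupport (by fun_prop)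
      (HasCompactSupport.of_compactSpace _)
  have hlower : δ * S ≤ ∑ i, ‖toL2 (f i)‖ ^ 2 := by
    simp_rw [hS, norm_toL2_sq]
    rw [← integral_finsetSum _ fun i _ => hgi _, ← integral_finsetSum _ fun i _ => hgi _,
      ← integral_const_mul]
    refine integral_mono ((integrable_finsetSum _ fun i _ => hgi _).const_mul _)
      (integrable_finsetSum _ fun i _ => hgi _) fun x => ?_
    simpa [hf] using hbound x fun k => polyMap (ψ k) x
  have hupper : ∑ i, ‖toL2 (f i)‖ ^ 2 ≤ n * (ε ^ 2 * n) * S := by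
    have h1 : (∑ k, ‖toL2 (polyMap (ψ k))‖) ^ 2 ≤ n * S := sq_sum_le_card_mul_sum_sq
    calc _ ≤ ∑ i : α, (ε * ∑ k, ‖toL2 (polyMap (ψ k))‖) ^ 2 := by
          gcongr with i
          exact hfle i
      _ = n * (ε ^ 2 * (∑ k, ‖toL2 (polyMap (ψ k))‖) ^ 2) := by
          rw [Finset.sum_const, Finset.card_univ, nsmul_eq_mul, mul_pow]
      _ ≤ n * (ε ^ 2 * (n * S)) := by gcongr
      _ = _ := by ring
  have := mul_lt_mul_of_pos_right hεδ hSpos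
  linarith

end Degeneracy

section Symbol

open Module MvPolynomial

lemma odd_sum_finrank (M : ℕ) : ∃ D ≥ M, Even D ∧
    Odd (∑ k, finrank ℂ (homogeneousSubmodule (Fin 3 ⊕ Fin 3) ℂ
      (D + (![2, 2, 4, 0] : Fin 4 → ℕ) k))) := by
  refine ⟨8 * M + 6, by omega, ⟨4 * M + 3, by ring⟩, ?_⟩
  simp only [finrank_homogeneousSubmodule, Fin.sum_univ_four, Fintype.card_sum, Fintype.card_fin,
    Matrix.cons_val]
  have h1 : (3 + 3 + (8 * M + 6 + 4) - 1).choose (8 * M + 6 + 4) = (8 * M + 15).choose 5 := by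
    rw [show 3 + 3 + (8 * M + 6 + 4) - 1 = 8 * M + 15 by omega]
    exact Nat.choose_symm_of_eq_add (by omega)
  have h2 : (3 + 3 + (8 * M + 6 + 0) - 1).choose (8 * M + 6 + 0) = (8 * M + 11).choose 5 := by
    rw [show 3 + 3 + (8 * M + 6 + 0) - 1 = 8 * M + 11 by omega]
    exact Nat.choose_symm_of_eq_add (by omega)
  rw [h1, h2]
  have h3 := odd_choose_five M
  have h4 := even_choose_five M
  generalize (8 * M + 15).choose 5 = a at *
  generalize (8 * M + 11).choose 5 = b at *
  generalize (3 + 3 + (8 * M + 6 + 2) - 1).choose (8 * M + 6 + 2) = c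
  exact (Even.add_odd ⟨c, rfl⟩ h3).add_even h4

/-- The symbol matrix of a triple of complex numbers. -/
def symbolMatrix {R : Type} [Ring R] [Star R] (f p q : R) : Fin 4 → Fin 4 → R :=
  ![![0, f, p, q], ![f, 0, star q, -star p], ![-q, -star p, star f, 0], ![-p, star q, 0, -star f]]

lemma sum_norm_sq_symbolMatrix (f p q : ℂ) (c : Fin 4 → ℂ) :
    ∑ i, ‖∑ k, symbolMatrix f p q i k * c k‖ ^ 2
      = (‖f‖ ^ 2 + ‖p‖ ^ 2 + ‖q‖ ^ 2) * ∑ k, ‖c k‖ ^ 2 := by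
  apply Complex.ofReal_injective
  push_cast
  simp only [← Complex.mul_conj', Fin.sum_univ_four, symbolMatrix, Matrix.cons_val, map_add,
    map_mul, map_neg, map_zero, Complex.star_def, Complex.conj_conj]
  ring

/-- There is no nowhere vanishing triple of functions on `S¹¹` with these equivariances. -/
theorem exists_common_zero (f p q : C(USphere (Fin 3 ⊕ Fin 3), ℂ))
    (hf : ∀ (u : ℂ) (hu : ‖u‖ = 1) x, f (rot u hu x) = f x)
    (hp : ∀ (u : ℂ) (hu : ‖u‖ = 1) x, u ^ 2 * p (rot u hu x) = p x)
    (hq : ∀ (u : ℂ) (hu : ‖u‖ = 1) x, q (rot u hu x) = u ^ 2 * q x)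
    (hf' : ∀ x, f (quat x) = -f x) (hp' : ∀ x, p (quat x) = q x) (hq' : ∀ x, q (quat x) = p x) :
    ∃ x, f x = 0 ∧ p x = 0 ∧ q x = 0 := by
  by_contra! h0
  have hcomp : ∀ i k x, symbolMatrix f p q i k x = symbolMatrix (f x) (p x) (q x) i k := by
    intro i k x
    fin_cases i <;> fin_cases k <;> rfl
  have : Nonempty (USphere (Fin 3 ⊕ Fin 3)) :=
    (NormedSpace.sphere_nonempty.2 zero_le_one).to_subtype
  obtain ⟨x₀, -, hx₀⟩ := isCompact_univ.exists_isMinOn Set.univ_nonempty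
    (f := fun x : USphere (Fin 3 ⊕ Fin 3) => ‖f x‖ ^ 2 + ‖p x‖ ^ 2 + ‖q x‖ ^ 2)
    (by fun_prop)
  have hpos : 0 < ‖f x₀‖ ^ 2 + ‖p x₀‖ ^ 2 + ‖q x₀‖ ^ 2 := by
    by_cases h1 : f x₀ = 0
    · by_cases h2 : p x₀ = 0
      · have := norm_pos_iff.2 (h0 x₀ h1 h2)
        positivity
      · have := norm_pos_iff.2 h2
        positivity
    · have := norm_pos_iff.2 h1
      positivity
  refine not_skew_of_odd (symbolMatrix f p q) ![2, 2, 4, 0] (fun k => ?_) odd_sum_finrank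
    (fun i k x => ?_) (fun u hu x i k => ?_) hpos (fun x c => ?_)
  · fin_cases k <;> decide
  · rw [hcomp, hcomp, hf', hp', hq']
    fin_cases i <;> fin_cases k <;> simp [symbolMatrix]
  · have hu2 : u * conj u = 1 := by rw [Complex.mul_conj', hu]; simp
    have hcp : u ^ 2 * conj (p x) = conj (p (rot u hu x)) := by
      rw [← hp u hu x, map_mul, map_pow, ← mul_assoc, ← mul_pow, hu2, one_pow, one_mul]
    have hcq : u ^ 2 * conj (q (rot u hu x)) = conj (q x) := by
      rw [hq u hu x, map_mul, map_pow, ← mul_assoc, ← mul_pow, hu2, one_pow, one_mul]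
    have hp2 := hp u hu x
    rw [hcomp, hcomp, hf, hq u hu x]
    rw [hq u hu x] at hcq
    fin_cases i <;> fin_cases k <;> simp [symbolMatrix] at hcq ⊢
    · linear_combination u ^ 2 * hp2
    · linear_combination u ^ 2 * hcq
    · exact hcp.symm
    · ring
    · linear_combination -u ^ 2 * hcp
    · exact hp2
    · exact hcq
  · simp only [hcomp, sum_norm_sq_symbolMatrix]
    exact mul_le_mul_of_nonneg_right (hx₀ (Set.mem_univ x))
      (Finset.sum_nonneg fun _ _ => sq_nonneg _)

end Symbol

end Harmonic

end GaussianMoments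

section Twistor

open GaussianMoments ComplexConjugate

/-- The quaternion with the given components. -/
def quatMk (a b c d : ℝ) : ℍ[ℝ] := ⟨a, b, c, d⟩

@[simp] lemma quatMk_re (a b c d : ℝ) : (quatMk a b c d).re = a := rfl
@[simp] lemma quatMk_imI (a b c d : ℝ) : (quatMk a b c d).imI = b := rfl
@[simp] lemma quatMk_imJ (a b c d : ℝ) : (quatMk a b c d).imJ = c := rfl
@[simp] lemma quatMk_imK (a b c d : ℝ) : (quatMk a b c d).imK = d := rfl

lemma cq_eq_quatMk (z : ℂ) : cq z = quatMk z.re z.im 0 0 := rfl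

/-- The vector of `ℍ³` with components `x + j y`, where `(x, y) ∈ ℂ³ ⊕ ℂ³`. -/
def toQ (z : Fin 3 ⊕ Fin 3 → ℂ) (k : Fin 3) : ℍ[ℝ] :=
  quatMk (z (.inl k)).re (z (.inl k)).im (z (.inr k)).re (-(z (.inr k)).im)

lemma toQ_smul (u : ℂ) (z : Fin 3 ⊕ Fin 3 → ℂ) : toQ (u • z) = fun k => toQ z k * cq u := by
  funext k
  ext <;> simp [toQ, cq_eq_quatMk] <;> ring

lemma toQ_quat (x : USphere (Fin 3 ⊕ Fin 3)) :
    toQ (quat x).1.ofLp = fun k => toQ x.1.ofLp k * quatMk 0 0 1 0 := by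
  funext k
  ext <;> simp [toQ, quat_ofLp]

lemma continuous_quatMk {X : Type*} [TopologicalSpace X] {a b c d : X → ℝ}
    (ha : Continuous a) (hb : Continuous b) (hc : Continuous c) (hd : Continuous d) :
    Continuous fun x => quatMk (a x) (b x) (c x) (d x) := by
  have : (fun x => quatMk (a x) (b x) (c x) (d x)) = fun x =>
      a x • (1 : ℍ[ℝ]) + b x • quatMk 0 1 0 0 + c x • quatMk 0 0 1 0 + d x • quatMk 0 0 0 1 := by
    funext x
    ext <;> simp
  rw [this]
  fun_prop

lemma continuous_toQ : Continuous fun x : USphere (Fin 3 ⊕ Fin 3) => toQ x.1.ofLp := by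
  refine continuous_pi fun k => ?_
  apply continuous_quatMk <;> fun_prop

lemma toQ_ne_zero (x : USphere (Fin 3 ⊕ Fin 3)) : toQ x.1.ofLp ≠ 0 := by
  intro h
  have hx : x.1 = 0 := by
    ext (k | k)
    · have := congrFun h k
      exact Complex.ext (congrArg QuaternionAlgebra.re this) (congrArg QuaternionAlgebra.imI this)
    · have := congrFun h k
      refine Complex.ext (congrArg QuaternionAlgebra.imJ this) ?_
      simpa [toQ] using congrArg QuaternionAlgebra.imK this
  have h1 := x.2
  rw [mem_sphere_zero_iff_norm, hx, norm_zero] at h1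
  exact zero_ne_one h1

lemma hrel_equivalence : Equivalence hrel where
  refl v := ⟨1, one_ne_zero, by simp⟩
  symm := by
    rintro v w ⟨a, ha, h⟩
    refine ⟨a⁻¹, inv_ne_zero ha, ?_⟩
    funext k
    rw [h, mul_assoc, mul_inv_cancel₀ ha, mul_one]
  trans := by
    rintro v w z ⟨a, ha, h⟩ ⟨b, hb, h'⟩
    refine ⟨a * b, mul_ne_zero ha hb, ?_⟩
    funext k
    simp only [h', h, mul_assoc]

lemma sum_normSq_ne_zero {v : Fin 3 → ℍ[ℝ]} (hv : v ≠ 0) : ∑ k, normSq (v k) ≠ 0 := by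
  obtain ⟨k, hk⟩ := Function.ne_iff.1 hv
  refine (Finset.sum_pos' (fun _ _ => normSq_nonneg) ⟨k, Finset.mem_univ k, ?_⟩).ne'
  exact lt_of_le_of_ne normSq_nonneg (Ne.symm (normSq_ne_zero.2 hk))

lemma cq_mul_I_mul_star (c : ℂ) :
    cq c * quatMk 0 1 0 0 * star (cq c) = normSq (cq c) • quatMk 0 1 0 0 := by
  ext <;> simp [cq_eq_quatMk, normSq_def'] <;> ring

/-- The skew-Hermitian matrix `v i v* / |v|²` attached to the complex line spanned by `v`. -/
def lineMatrix (v : V3x) (k l : Fin 3) : ℍ[ℝ] :=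
  (∑ m, normSq (v.1 m))⁻¹ • (v.1 k * quatMk 0 1 0 0 * star (v.1 l))

lemma lineMatrix_eq_of_crel {v w : V3x} (h : crel v w) : lineMatrix v = lineMatrix w := by
  obtain ⟨c, hc, h⟩ := h
  have hcne : normSq (cq c) ≠ 0 := normSq_ne_zero.2 (cq_ne_zero hc)
  funext k l
  have h1 : v.1 k * cq c * quatMk 0 1 0 0 * star (v.1 l * cq c)
      = normSq (cq c) • (v.1 k * quatMk 0 1 0 0 * star (v.1 l)) := by
    have : v.1 k * cq c * quatMk 0 1 0 0 * star (v.1 l * cq c)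
        = v.1 k * (cq c * quatMk 0 1 0 0 * star (cq c)) * star (v.1 l) := by
      simp only [star_mul, mul_assoc]
    rw [this, cq_mul_I_mul_star, mul_smul_comm, smul_mul_assoc]
  simp only [lineMatrix, h]
  rw [h1, smul_smul]
  simp only [map_mul, ← Finset.sum_mul]
  rw [mul_inv, inv_mul_cancel_right₀ hcne]

/-- The map from `ℂP⁵` to quaternionic matrices induced by `lineMatrix`. -/
def cpMatrix : CP5 → Fin 3 → Fin 3 → ℍ[ℝ] :=
  Quot.lift lineMatrix fun _ _ => lineMatrix_eq_of_crel

lemma continuous_cpMatrix : Continuous cpMatrix := by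
  refine continuous_quot_lift _ ?_
  refine continuous_pi fun k => continuous_pi fun l => ?_
  have hc : Continuous fun v : V3x => v.1 := continuous_subtype_val
  have h1 : ∀ m, Continuous fun v : V3x => v.1 m := fun m => (continuous_apply m).comp hc
  refine Continuous.smul (Continuous.inv₀ (continuous_finsetSum _ fun m _ =>
    continuous_normSq.comp (h1 m)) fun v => sum_normSq_ne_zero v.2) ?_
  exact ((h1 k).mul continuous_const).mul (continuous_star.comp (h1 l))

/-- The pair of rescaled matrices attached to a point of the fibred join. -/
def joinMatrix : E1 → Bool → Fin 3 → Fin 3 → ℍ[ℝ] :=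
  Quot.lift (fun x b => cond b ((x.1.2.2 : ℝ) • cpMatrix x.1.2.1)
    ((1 - (x.1.2.2 : ℝ)) • cpMatrix x.1.1)) (by
    rintro x y (⟨hx, hy, h⟩ | ⟨hx, hy, h⟩) <;> funext b <;> cases b <;> simp [hx, hy, h])

lemma continuous_joinMatrix : Continuous joinMatrix := by
  refine continuous_quot_lift _ (continuous_pi fun b => ?_)
  have hc : Continuous fun x : JSp => x.1 := continuous_subtype_val
  have ht : Continuous fun x : JSp => (x.1.2.2 : ℝ) :=
    continuous_subtype_val.comp (continuous_snd.comp (continuous_snd.comp hc))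
  cases b
  · exact (continuous_const.sub ht).smul (continuous_cpMatrix.comp (continuous_fst.comp hc))
  · exact ht.smul (continuous_cpMatrix.comp (continuous_fst.comp (continuous_snd.comp hc)))

/-- The quaternionic sesquilinear form `X* M X`. -/
def sesqForm (M : Fin 3 → Fin 3 → ℍ[ℝ]) (X : Fin 3 → ℍ[ℝ]) : ℍ[ℝ] :=
  ∑ k, ∑ l, star (X k) * M k l * X l

lemma sesqForm_mul_right (M : Fin 3 → Fin 3 → ℍ[ℝ]) (X : Fin 3 → ℍ[ℝ]) (g : ℍ[ℝ]) :
    sesqForm M (fun k => X k * g) = star g * sesqForm M X * g := by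
  simp only [sesqForm, Finset.mul_sum, Finset.sum_mul, star_mul, mul_assoc]

lemma sesqForm_smul (r : ℝ) (M : Fin 3 → Fin 3 → ℍ[ℝ]) (X : Fin 3 → ℍ[ℝ]) :
    sesqForm (r • M) X = r • sesqForm M X := by
  simp only [sesqForm, Pi.smul_apply, mul_smul_comm, smul_mul_assoc, Finset.smul_sum]

lemma sesqForm_lineMatrix {v X : V3x} (h : hrel X v) :
    ∃ a : ℍ[ℝ], a ≠ 0 ∧ ∃ r : ℝ, r ≠ 0 ∧
      sesqForm (lineMatrix v) X.1 = r • (a * quatMk 0 1 0 0 * star a) := by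
  obtain ⟨a, ha, h⟩ := h
  refine ⟨a, ha, (∑ m, normSq (v.1 m))⁻¹ * ((∑ k, normSq (X.1 k)) * ∑ k, normSq (X.1 k)),
    mul_ne_zero (inv_ne_zero (sum_normSq_ne_zero v.2))
      (mul_ne_zero (sum_normSq_ne_zero X.2) (sum_normSq_ne_zero X.2)), ?_⟩
  have hkl : ∀ k l, star (X.1 k) * lineMatrix v k l * X.1 l = (∑ m, normSq (v.1 m))⁻¹ •
      (normSq (X.1 k) * normSq (X.1 l)) • (a * quatMk 0 1 0 0 * star a) := by
    intro k l
    simp only [lineMatrix, mul_smul_comm, smul_mul_assoc]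
    congr 1
    have : star (X.1 k) * (v.1 k * quatMk 0 1 0 0 * star (v.1 l)) * X.1 l
        = (star (X.1 k) * X.1 k) * (a * quatMk 0 1 0 0 * star a) * (star (X.1 l) * X.1 l) := by
      simp only [h, star_mul, mul_assoc]
    rw [this, star_mul_self, star_mul_self, coe_mul_eq_smul, mul_coe_eq_smul, smul_smul, mul_comm]
  simp only [sesqForm, hkl, ← Finset.sum_smul, smul_smul, ← Finset.mul_sum, ← Finset.sum_mul]

lemma sesqForm_cpMatrix {e : CP5} {X : V3x} (h : twistor e = Quot.mk hrel X) :
    (sesqForm (cpMatrix e) X.1).re = 0 ∧ sesqForm (cpMatrix e) X.1 ≠ 0 := by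
  induction e using Quot.ind with
  | mk v =>
    obtain ⟨a, ha, r, hr, he⟩ := sesqForm_lineMatrix
      (hrel_equivalence.symm ((hrel_equivalence.quot_mk_eq_iff v X).1 h))
    change (sesqForm (lineMatrix v) X.1).re = 0 ∧ sesqForm (lineMatrix v) X.1 ≠ 0
    rw [he]
    refine ⟨?_, smul_ne_zero hr (mul_ne_zero (mul_ne_zero ha fun h => ?_) (star_ne_zero.2 ha))⟩
    · simp
      ring_nf
      simp
    · exact one_ne_zero (congrArg QuaternionAlgebra.imI h)

lemma sesqForm_joinMatrix {e : E1} {X : V3x} (h : q1 e = Quot.mk hrel X) :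
    (∀ b, (sesqForm (joinMatrix e b) X.1).re = 0) ∧ ∃ b, sesqForm (joinMatrix e b) X.1 ≠ 0 := by
  induction e using Quot.ind with
  | mk x =>
    obtain ⟨hre, hne⟩ := sesqForm_cpMatrix (e := x.1.1) h
    obtain ⟨hre1, hne1⟩ := sesqForm_cpMatrix (e := x.1.2.1) (x.2.symm.trans h)
    have h0 : sesqForm (joinMatrix (Quot.mk jrel x) false) X.1
        = (1 - (x.1.2.2 : ℝ)) • sesqForm (cpMatrix x.1.1) X.1 := sesqForm_smul _ _ _
    have h1 : sesqForm (joinMatrix (Quot.mk jrel x) true) X.1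
        = (x.1.2.2 : ℝ) • sesqForm (cpMatrix x.1.2.1) X.1 := sesqForm_smul _ _ _
    refine ⟨?_, ?_⟩
    · rintro (_ | _)
      · simp [h0, hre]
      · simp [h1, hre1]
    · by_cases ht : (x.1.2.2 : ℝ) = 0
      · exact ⟨false, by rw [h0, ht]; simpa using hne⟩
      · exact ⟨true, by rw [h1]; exact smul_ne_zero ht hne1⟩

/-- The coefficient of `j` in the decomposition `ℍ = ℂ ⊕ ℂ j`. -/
def jPart (w : ℍ[ℝ]) : ℂ := ⟨w.imJ, w.imK⟩

lemma continuous_jPart : Continuous jPart := by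
  have : jPart = fun w : ℍ[ℝ] => (w.imJ : ℂ) + w.imK * Complex.I := by
    funext w
    exact Complex.ext (by simp [jPart]) (by simp [jPart])
  rw [this]
  exact (Complex.continuous_ofReal.comp continuous_imJ).add
    ((Complex.continuous_ofReal.comp continuous_imK).mul continuous_const)

lemma conj_cq_imI {u : ℂ} (hu : ‖u‖ = 1) (w : ℍ[ℝ]) : (star (cq u) * w * cq u).imI = w.imI := by
  have h := Complex.sq_norm u
  rw [hu, Complex.normSq_apply] at h
  simp [cq_eq_quatMk]
  linear_combination -w.imI * h

lemma conj_cq_jPart {u : ℂ} (hu : ‖u‖ = 1) (w : ℍ[ℝ]) :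
    u ^ 2 * jPart (star (cq u) * w * cq u) = jPart w := by
  have hu2 : u * conj u = 1 := by rw [Complex.mul_conj', hu]; simp
  have h : jPart (star (cq u) * w * cq u) = conj u ^ 2 * jPart w := by
    apply Complex.ext <;> simp [jPart, cq_eq_quatMk, pow_two] <;> ring
  rw [h, ← mul_assoc, ← mul_pow, hu2, one_pow, one_mul]

lemma conj_j_imI (w : ℍ[ℝ]) :
    (star (quatMk 0 0 1 0) * w * quatMk 0 0 1 0).imI = -w.imI := by
  simp

lemma conj_j_jPart (w : ℍ[ℝ]) :
    jPart (star (quatMk 0 0 1 0) * w * quatMk 0 0 1 0) = conj (jPart w) := by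
  apply Complex.ext <;> simp [jPart]

/-- The nonzero vector of `ℍ³` given by a point of the unit sphere of `ℂ³ ⊕ ℂ³`. -/
def sphereVec (x : USphere (Fin 3 ⊕ Fin 3)) : V3x := ⟨toQ x.1.ofLp, toQ_ne_zero x⟩

lemma mk_sphereVec_rot (u : ℂ) (hu : ‖u‖ = 1) (x : USphere (Fin 3 ⊕ Fin 3)) :
    (Quot.mk hrel (sphereVec (rot u hu x)) : HP2) = Quot.mk hrel (sphereVec x) := by
  refine (Quot.sound ⟨cq u, cq_ne_zero (norm_ne_zero_iff.1 (by simp [hu])), ?_⟩).symm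
  simp only [sphereVec, rot_ofLp, toQ_smul]

lemma mk_sphereVec_quat (x : USphere (Fin 3 ⊕ Fin 3)) :
    (Quot.mk hrel (sphereVec (quat x)) : HP2) = Quot.mk hrel (sphereVec x) := by
  refine (Quot.sound ⟨quatMk 0 0 1 0, fun h => ?_, ?_⟩).symm
  · exact one_ne_zero (congrArg QuaternionAlgebra.imJ h)
  · simp only [sphereVec, toQ_quat]

/-- The quaternionic functions on the unit sphere induced by a map `HP2 → E1`. -/
def joinFun (s : HP2 → E1) (b : Bool) (x : USphere (Fin 3 ⊕ Fin 3)) : ℍ[ℝ] :=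
  sesqForm (joinMatrix (s (Quot.mk hrel (sphereVec x))) b) (sphereVec x).1

lemma continuous_joinFun {s : HP2 → E1} (hs : Continuous s) (b : Bool) :
    Continuous (joinFun s b) := by
  have hv : Continuous sphereVec := continuous_toQ.subtype_mk _
  have hm : Continuous fun x => joinMatrix (s (Quot.mk hrel (sphereVec x))) b :=
    (continuous_apply b).comp
      (continuous_joinMatrix.comp (hs.comp (continuous_quot_mk.comp hv)))
  have hX : ∀ k, Continuous fun x => (sphereVec x).1 k := fun k =>
    (continuous_apply k).comp continuous_toQ
  unfold joinFun sesqForm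
  refine continuous_finsetSum _ fun k _ => continuous_finsetSum _ fun l _ => ?_
  exact ((continuous_star.comp (hX k)).mul
    ((continuous_apply l).comp ((continuous_apply k).comp hm))).mul (hX l)

lemma joinFun_rot (s : HP2 → E1) (b : Bool) (u : ℂ) (hu : ‖u‖ = 1)
    (x : USphere (Fin 3 ⊕ Fin 3)) :
    joinFun s b (rot u hu x) = star (cq u) * joinFun s b x * cq u := by
  rw [joinFun, mk_sphereVec_rot, joinFun, ← sesqForm_mul_right]
  simp only [sphereVec, rot_ofLp, toQ_smul]

lemma joinFun_quat (s : HP2 → E1) (b : Bool) (x : USphere (Fin 3 ⊕ Fin 3)) :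
    joinFun s b (quat x) = star (quatMk 0 0 1 0) * joinFun s b x * quatMk 0 0 1 0 := by
  rw [joinFun, mk_sphereVec_quat, joinFun, ← sesqForm_mul_right]
  simp only [sphereVec, toQ_quat]

lemma eq_zero_of_add_I_mul {a b : ℝ} (h : (a : ℂ) + Complex.I * b = 0) : a = 0 ∧ b = 0 :=
  ⟨by simpa using congrArg Complex.re h, by simpa using congrArg Complex.im h⟩

lemma eq_zero_of_conj_add_I_mul {a b : ℂ} (h : a + Complex.I * b = 0)
    (h' : conj a + Complex.I * conj b = 0) : a = 0 ∧ b = 0 := by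
  have h2 := congrArg conj h'
  simp only [map_add, map_mul, Complex.conj_conj, Complex.conj_I, map_zero] at h2
  have ha : a = 0 := by linear_combination (h + h2) / 2
  refine ⟨ha, ?_⟩
  rw [ha, zero_add] at h
  exact (mul_eq_zero.1 h).resolve_left Complex.I_ne_zero

lemma not_continuous_section (s : HP2 → E1) (hs : Continuous s) :
    ¬ ∀ b : HP2, q1 (s b) = b := by
  intro hsec
  have hI : ∀ b, Continuous fun x => ((joinFun s b x).imI : ℂ) := fun b =>
    Complex.continuous_ofReal.comp (continuous_imI.comp (continuous_joinFun hs b))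
  have hJ : ∀ b, Continuous fun x => jPart (joinFun s b x) := fun b =>
    continuous_jPart.comp (continuous_joinFun hs b)
  obtain ⟨x, hf, hp, hq⟩ := exists_common_zero
    ⟨fun x => ((joinFun s false x).imI : ℂ) + Complex.I * (joinFun s true x).imI,
      (hI false).add (continuous_const.mul (hI true))⟩
    ⟨fun x => jPart (joinFun s false x) + Complex.I * jPart (joinFun s true x),
      (hJ false).add (continuous_const.mul (hJ true))⟩
    ⟨fun x => conj (jPart (joinFun s false x)) + Complex.I * conj (jPart (joinFun s true x)),
      (Complex.continuous_conj.comp (hJ false)).add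
        (continuous_const.mul (Complex.continuous_conj.comp (hJ true)))⟩
    (fun u hu x => by simp only [ContinuousMap.coe_mk, joinFun_rot, conj_cq_imI hu])
    (fun u hu x => by
      simp only [ContinuousMap.coe_mk, joinFun_rot]
      linear_combination conj_cq_jPart hu (joinFun s false x)
        + Complex.I * conj_cq_jPart hu (joinFun s true x))
    (fun u hu x => by
      have hu2 : u * conj u = 1 := by rw [Complex.mul_conj', hu]; simp
      have h : ∀ w : ℍ[ℝ], conj (jPart (star (cq u) * w * cq u)) = u ^ 2 * conj (jPart w) := by
        intro w
        rw [← conj_cq_jPart hu w, map_mul, map_pow, ← mul_assoc, ← mul_pow, hu2, one_pow,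
          one_mul]
      simp only [ContinuousMap.coe_mk, joinFun_rot, h]
      ring)
    (fun x => by
      simp only [ContinuousMap.coe_mk, joinFun_quat, conj_j_imI]
      push_cast
      ring)
    (fun x => by simp only [ContinuousMap.coe_mk, joinFun_quat, conj_j_jPart])
    (fun x => by simp only [ContinuousMap.coe_mk, joinFun_quat, conj_j_jPart, Complex.conj_conj])
  obtain ⟨hre, b, hb⟩ := sesqForm_joinMatrix (hsec (Quot.mk hrel (sphereVec x)))
  obtain ⟨hf0, hf1⟩ := eq_zero_of_add_I_mul hf
  obtain ⟨hp0, hp1⟩ := eq_zero_of_conj_add_I_mul hp hq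
  have hi : (joinFun s b x).imI = 0 := by cases b <;> assumption
  have hj : jPart (joinFun s b x) = 0 := by cases b <;> assumption
  refine hb (QuaternionAlgebra.ext (hre b) hi ?_ ?_)
  · exact congrArg Complex.re hj
  · exact congrArg Complex.im hj

end Twistor

/-- The 2-fold fibred join `q(1) : E(1) → ℍP²` of the twistor map admits no
continuous section. -/
theorem q1_no_section :
    ¬ ∃ s : HP2 → E1, Continuous s ∧ ∀ b : HP2, q1 (s b) = b := by
  rintro ⟨s, hs, hsec⟩
  exact not_continuous_section s hs hsec

end
end

section
/- Let ℍP¹ ⊆ ℍP² be the subspace of quaternionic lines contained in ℍ² × {0}. Then the 2-fold fibred join q(1) : E(1) → ℍP² of the twistor map admits a continuous section over ℍP¹; that is, there is a continuous map s : ℍP¹ → E(1) with q(1) ∘ s equal to the inclusion ℍP¹ ↪ ℍP². -/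
noncomputable section

open Quaternion

open unitInterval

/-- `ℍP¹ ⊆ ℍP²`: the subspace of quaternionic lines contained in `ℍ² × {0}`,
i.e. lines spanned by a vector whose last coordinate vanishes. -/
def HP1 : Set HP2 := {L | ∃ v : V3x, Quot.mk hrel v = L ∧ v.1 2 = 0}

open Topology

lemma continuous_coord (k : Fin 3) : Continuous fun v : V3x => v.1 k :=
  (continuous_apply k).comp continuous_subtype_val

lemma isOpenQuotientMap_mk_hrel :
    IsOpenQuotientMap (Quot.mk hrel : V3x → HP2) := by
  refine ⟨Quot.mk_surjective, continuous_quot_mk, fun U hU => ?_⟩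
  have hmul (a : ℍ[ℝ]) (ha : a ≠ 0) (v : V3x) : (fun i => v.1 i * a) ≠ 0 := fun h =>
    v.2 (funext fun i => (mul_eq_zero.1 (congrFun h i)).resolve_right ha)
  have hequiv : Equivalence hrel :=
    { refl := fun v => ⟨1, one_ne_zero, by simp⟩
      symm := by
        rintro v w ⟨a, ha, h⟩
        exact ⟨a⁻¹, inv_ne_zero ha, by simp [h, ha]⟩
      trans := by
        rintro u v w ⟨a, ha, h⟩ ⟨b, hb, h'⟩
        exact ⟨a * b, mul_ne_zero ha hb, by simp [h, h', mul_assoc]⟩ }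
  have himage : (Quot.mk hrel : V3x → HP2) ⁻¹' (Quot.mk hrel '' U) =
      ⋃ a : {a : ℍ[ℝ] // a ≠ 0}, (fun v : V3x => (⟨_, hmul a.1 a.2 v⟩ : V3x)) ⁻¹' U := by
    ext v
    simp only [Set.mem_preimage, Set.mem_image, Set.mem_iUnion]
    constructor
    · rintro ⟨w, hw, h⟩
      obtain ⟨a, ha, h'⟩ := hequiv.symm ((Equivalence.quot_mk_eq_iff hequiv w v).1 h)
      refine ⟨⟨a, ha⟩, ?_⟩
      rwa [show w = ⟨_, hmul a ha v⟩ from Subtype.ext h'] at hw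
    · rintro ⟨a, ha⟩
      exact ⟨_, ha, (Quot.sound ⟨a.1, a.2, rfl⟩ : Quot.mk hrel v = _).symm⟩
  change IsOpen ((Quot.mk hrel : V3x → HP2) ⁻¹' (Quot.mk hrel '' U))
  rw [himage]
  refine isOpen_iUnion fun a => hU.preimage ?_
  exact Continuous.subtype_mk (continuous_pi fun k => (continuous_coord k).mul continuous_const) _

open Classical in
/-- The nonzero vector `w` as a point of `V3x`, with an arbitrary value at `0`. -/
def toV3x (w : Fin 3 → ℍ[ℝ]) : V3x :=
  if h : w ≠ 0 then ⟨w, h⟩ else ⟨1, one_ne_zero⟩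

lemma continuousAt_toV3x {w : Fin 3 → ℍ[ℝ]} (hw : w ≠ 0) : ContinuousAt toV3x w := by
  have hemb : IsOpenEmbedding (Subtype.val : V3x → Fin 3 → ℍ[ℝ]) :=
    isOpen_ne.isOpenEmbedding_subtypeVal
  have hid : toV3x ∘ (Subtype.val : V3x → Fin 3 → ℍ[ℝ]) = id := by
    funext v
    simp [toV3x, v.2]
  refine (hemb.continuousAt_iff (x := ⟨w, hw⟩)).1 ?_
  rw [hid]
  exact continuousAt_id

open Classical in
/-- The coordinate used for normalization: the `i`-th one if it is nonzero, else the `j`-th. -/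
def pivot (i j : Fin 3) (v : V3x) : ℍ[ℝ] := if v.1 i ≠ 0 then v.1 i else v.1 j

/-- The complex line spanned by the representative of a quaternionic line whose
`i`-th coordinate (or `j`-th, when the `i`-th vanishes) is `1`. -/
def chartSection (i j : Fin 3) : HP2 → CP5 :=
  Quot.lift (fun v => Quot.mk crel (toV3x fun k => v.1 k * (pivot i j v)⁻¹)) (by
    rintro v w ⟨a, ha, h⟩
    have hp : pivot i j w = pivot i j v * a := by
      by_cases hv : v.1 i = 0 <;> simp [pivot, h, hv, ha]
    have hnormalize : (fun k => w.1 k * (pivot i j w)⁻¹) = fun k => v.1 k * (pivot i j v)⁻¹ := by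
      simp only [hp, h, mul_inv_rev, mul_assoc, mul_inv_cancel_left₀ ha]
    exact congrArg (fun u => Quot.mk crel (toV3x u)) hnormalize.symm)

lemma smul_pivot_inv_ne_zero {v : V3x} {p : ℍ[ℝ]} (hp : p ≠ 0) :
    (fun k => v.1 k * p⁻¹) ≠ 0 := fun h =>
  v.2 (funext fun k => (mul_eq_zero.1 (congrFun h k)).resolve_right (inv_ne_zero hp))

lemma twistor_chartSection {i j : Fin 3} {v : V3x} (hv : v.1 i ≠ 0 ∨ v.1 j ≠ 0) :
    twistor (chartSection i j (Quot.mk hrel v)) = Quot.mk hrel v := by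
  have hp : pivot i j v ≠ 0 := by
    unfold pivot
    split_ifs with h
    · exact h
    · exact hv.resolve_left h
  refine (Quot.sound ⟨(pivot i j v)⁻¹, inv_ne_zero hp, ?_⟩ : Quot.mk hrel v = _).symm
  rw [toV3x, dif_pos (smul_pivot_inv_ne_zero hp)]

lemma continuousAt_chartSection {i : Fin 3} (j : Fin 3) {v : V3x} (hv : v.1 i ≠ 0) :
    ContinuousAt (chartSection i j) (Quot.mk hrel v) := by
  refine (isOpenQuotientMap_mk_hrel.continuousAt_comp_iff).1 ?_
  have hpivot : ContinuousAt (pivot i j) v := by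
    refine (continuous_coord i).continuousAt.congr ?_
    filter_upwards [(continuous_coord i).continuousAt.eventually_ne hv] with w hw
    simp [pivot, hw]
  have hp : pivot i j v ≠ 0 := by simp [pivot, hv]
  have hnormalize : ContinuousAt (fun w : V3x => fun k => w.1 k * (pivot i j w)⁻¹) v :=
    continuousAt_pi.2 fun k => (continuous_coord k).continuousAt.mul (hpivot.inv₀ hp)
  exact (continuous_quot_mk (r := crel)).continuousAt.comp
    (ContinuousAt.comp (f := fun w : V3x => fun k => w.1 k * (pivot i j w)⁻¹)
      (continuousAt_toV3x (smul_pivot_inv_ne_zero hp)) hnormalize)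

/-- The relative size of the second coordinate among the first two. -/
def secondWeight : HP2 → ℝ :=
  Quot.lift (fun v => ‖v.1 1‖ / (‖v.1 0‖ + ‖v.1 1‖)) (by
    rintro v w ⟨a, ha, h⟩
    simp only [h, norm_mul, ← add_mul]
    rw [mul_div_mul_right _ _ (norm_ne_zero_iff.2 ha)])

lemma continuousAt_secondWeight {v : V3x} (hv : v.1 0 ≠ 0 ∨ v.1 1 ≠ 0) :
    ContinuousAt secondWeight (Quot.mk hrel v) := by
  refine (isOpenQuotientMap_mk_hrel.continuousAt_comp_iff).1 ?_
  refine ContinuousAt.div (continuous_coord 1).norm.continuousAt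
    ((continuous_coord 0).norm.add (continuous_coord 1).norm).continuousAt ?_
  rcases hv with h | h
  · have := norm_pos_iff.2 h
    positivity
  · have := norm_pos_iff.2 h
    positivity

/-- The join parameter: `0` where the second coordinate is small, `1` where it is large. -/
def joinParam (L : HP2) : I := Set.projIcc 0 1 zero_le_one (3 * secondWeight L - 1)

lemma exists_rep_of_mem_HP1 {L : HP2} (hL : L ∈ HP1) :
    ∃ v : V3x, Quot.mk hrel v = L ∧ (v.1 0 ≠ 0 ∨ v.1 1 ≠ 0) := by
  obtain ⟨v, rfl, hv⟩ := hL
  refine ⟨v, rfl, ?_⟩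
  by_contra! h
  exact v.2 (funext fun k => by fin_cases k <;> simp [h.1, h.2, hv])

lemma twistor_chartSection_zero_one {L : HP2} (hL : L ∈ HP1) :
    twistor (chartSection 0 1 L) = L := by
  obtain ⟨v, rfl, hv⟩ := exists_rep_of_mem_HP1 hL
  exact twistor_chartSection hv

lemma twistor_chartSection_one_zero {L : HP2} (hL : L ∈ HP1) :
    twistor (chartSection 1 0 L) = L := by
  obtain ⟨v, rfl, hv⟩ := exists_rep_of_mem_HP1 hL
  exact twistor_chartSection hv.symm

/-- The section of the fibred join over `ℍP¹` obtained by joining the two chart sections. -/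
def joinSection (x : HP1) : E1 :=
  Quot.mk jrel ⟨(chartSection 0 1 x, chartSection 1 0 x, joinParam x),
    (twistor_chartSection_zero_one x.2).trans (twistor_chartSection_one_zero x.2).symm⟩

lemma continuous_joinSection : Continuous joinSection := by
  refine continuous_iff_continuousAt.2 fun x => ?_
  obtain ⟨v, hvx, hv⟩ := exists_rep_of_mem_HP1 x.2
  have hval : ContinuousAt (Subtype.val : HP1 → HP2) x := continuous_subtype_val.continuousAt
  have hweight : ContinuousAt (fun y : HP1 => secondWeight y) x :=
    ContinuousAt.comp (hvx ▸ continuousAt_secondWeight hv) hval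
  have hweight_eq : secondWeight x = ‖v.1 1‖ / (‖v.1 0‖ + ‖v.1 1‖) := by rw [← hvx]; rfl
  have hsection {i : Fin 3} (j : Fin 3) (h : v.1 i ≠ 0) :
      ContinuousAt (fun y : HP1 => chartSection i j y) x :=
    ContinuousAt.comp (hvx ▸ continuousAt_chartSection j h) hval
  have hmk {f : HP1 → JSp} (hf : ContinuousAt (fun y => (f y).1) x) :
      ContinuousAt (fun y => (Quot.mk jrel (f y) : E1)) x :=
    (continuous_quot_mk (r := jrel)).continuousAt.comp
      (IsInducing.subtypeVal.continuousAt_iff.2 hf)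
  by_cases h1 : v.1 1 = 0
  · have h0 : v.1 0 ≠ 0 := hv.resolve_right (not_not.2 h1)
    have hsmall : ∀ᶠ y : HP1 in 𝓝 x, secondWeight y < 1 / 3 :=
      hweight.eventually_lt continuousAt_const (by simp [hweight_eq, h1])
    refine (hmk (f := fun y => ⟨(chartSection 0 1 y, chartSection 0 1 y, 0), rfl⟩)
      ((hsection 1 h0).prodMk ((hsection 1 h0).prodMk continuousAt_const))).congr ?_
    filter_upwards [hsmall] with y hy
    exact Quot.sound (Or.inl ⟨rfl, Set.projIcc_of_le_left zero_le_one (by linarith), rfl⟩)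
  by_cases h0 : v.1 0 = 0
  · have hlarge : ∀ᶠ y : HP1 in 𝓝 x, 2 / 3 < secondWeight y :=
      continuousAt_const.eventually_lt hweight (by
        rw [hweight_eq, h0, norm_zero, zero_add, div_self (norm_ne_zero_iff.2 h1)]
        norm_num)
    refine (hmk (f := fun y => ⟨(chartSection 1 0 y, chartSection 1 0 y, 1), rfl⟩)
      ((hsection 0 h1).prodMk ((hsection 0 h1).prodMk continuousAt_const))).congr ?_
    filter_upwards [hlarge] with y hy
    exact Quot.sound (Or.inr ⟨rfl, Set.projIcc_of_right_le zero_le_one (by linarith), rfl⟩)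
  · refine hmk ((hsection 1 h0).prodMk ((hsection 0 h1).prodMk ?_))
    exact continuous_projIcc.continuousAt.comp
      ((continuousAt_const.mul hweight).sub continuousAt_const)

/-- The 2-fold fibred join `q(1) : E(1) → ℍP²` of the twistor map admits a
continuous section over `ℍP¹`. -/
theorem q1_section_over_HP1 :
    ∃ s : HP1 → E1, Continuous s ∧ ∀ x : HP1, q1 (s x) = (x : HP2) :=
  ⟨joinSection, continuous_joinSection, fun x => twistor_chartSection_zero_one x.2⟩

end
end

section
/- Let q : E → B be a Hurewicz fibration, let E ×_B E = {(e₀, e₁) ∈ E × E : q(e₀) = q(e₁)} with projections π₁, π₂ : E ×_B E → E, and let f : E → E(1) be the continuous map f(e) = [e, e, 0] including E as the t = 0 end of the fibred join. Then the mapping cone of f is homotopy equivalent to the mapping cone of the projection π₁ (equivalently of π₂, since the coordinate-swap homeomorphism of E ×_B E interchanges the two projections and induces a homeomorphism of their mapping cones). -/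
/-!
For a Hurewicz fibration `q : E → B`, the mapping cone of the inclusion
`f : E → E(1)`, `f e = [e, e, 0]`, of `E` into the total space of the 2-fold
fibred join is homotopy equivalent to the mapping cone of the projection
`π₁ : E ×_B E → E`.
-/

noncomputable section

open unitInterval

universe u

/-- The relation generating the mapping cone of `f : A → X`:  the quotient of
`X ⊕ (A × I)` by `(a, 1) ∼ f a` and `(a, 0) ∼ (a', 0)`. -/
def coneRel {A X : Type u} [TopologicalSpace A] [TopologicalSpace X] (f : A → X) :
    X ⊕ A × I → X ⊕ A × I → Prop := fun p q =>
  (∃ a, p = Sum.inr (a, 1) ∧ q = Sum.inl (f a)) ∨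
  (∃ a a', p = Sum.inr (a, 0) ∧ q = Sum.inr (a', 0))

/-- The mapping cone of a map `f : A → X`, with the quotient topology. -/
def MappingCone {A X : Type u} [TopologicalSpace A] [TopologicalSpace X] (f : A → X) : Type u :=
  Quot (coneRel f)

instance {A X : Type u} [TopologicalSpace A] [TopologicalSpace X] (f : A → X) :
    TopologicalSpace (MappingCone f) := instTopologicalSpaceQuot

/-- `q : E → B` is a Hurewicz fibration:  it has the homotopy lifting property
with respect to all spaces. -/
def IsHurewiczFibration {E B : Type u} [TopologicalSpace E] [TopologicalSpace B]
    (q : E → B) : Prop :=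
  ∀ (Z : Type u) [TopologicalSpace Z] (g : C(Z, E)) (h : C(Z × I, B)),
    (∀ z, h (z, 0) = q (g z)) →
    ∃ H : C(Z × I, E), (∀ z, H (z, 0) = g z) ∧ ∀ p, q (H p) = h p

section FibredJoin

variable {E B : Type u} [TopologicalSpace E] [TopologicalSpace B] (q : E → B)

/-- The fibre product `E ×_B E = {(e₀, e₁) : q e₀ = q e₁}`. -/
def FibreProd : Type u := {p : E × E // q p.1 = q p.2}

instance : TopologicalSpace (FibreProd q) := instTopologicalSpaceSubtype

/-- The first projection `π₁ : E ×_B E → E`. -/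
def fibreProdFst : FibreProd q → E := fun p => p.1.1

/-- The second projection `π₂ : E ×_B E → E`. -/
def fibreProdSnd : FibreProd q → E := fun p => p.1.2

/-- The underlying space of the 2-fold fibred join, before quotienting:
triples `(e₀, e₁, t)` with `q e₀ = q e₁`. -/
def FJSp : Type u := {p : E × E × I // q p.1 = q p.2.1}

instance : TopologicalSpace (FJSp q) := instTopologicalSpaceSubtype

/-- The join identifications: `(e₀, e₁, 0) ∼ (e₀, e₁', 0)` and
`(e₀, e₁, 1) ∼ (e₀', e₁, 1)`. -/
def fjrel : FJSp q → FJSp q → Prop := fun x y =>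
  (x.1.2.2 = 0 ∧ y.1.2.2 = 0 ∧ x.1.1 = y.1.1) ∨
  (x.1.2.2 = 1 ∧ y.1.2.2 = 1 ∧ x.1.2.1 = y.1.2.1)

/-- The total space `E(1)` of the 2-fold fibred join of `q`. -/
def FJoin : Type u := Quot (fjrel q)

instance : TopologicalSpace (FJoin q) := instTopologicalSpaceQuot

/-- The inclusion `f : E → E(1)`, `f e = [e, e, 0]`, of `E` as the `t = 0` end
of the fibred join. -/
def joinIncl : E → FJoin q := fun e => Quot.mk _ ⟨(e, e, 0), rfl⟩

end FibredJoin

section MappingCone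

variable {A X Z : Type u} [TopologicalSpace A] [TopologicalSpace X] [TopologicalSpace Z]
  {f : A → X}

namespace MappingCone

/-- The inclusion of the base `X` into the mapping cone of `f : A → X`. -/
def base (f : A → X) (x : X) : MappingCone f := Quot.mk _ (Sum.inl x)

/-- The map `A × I → C_f` onto the conical part of the mapping cone. -/
def cone (f : A → X) (a : A) (t : I) : MappingCone f := Quot.mk _ (Sum.inr (a, t))

lemma cone_one (a : A) : cone f a 1 = base f (f a) :=
  Quot.sound (Or.inl ⟨a, rfl, rfl⟩)

lemma cone_zero (a a' : A) : cone f a 0 = cone f a' 0 :=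
  Quot.sound (Or.inr ⟨a, a', rfl, rfl⟩)

lemma continuous_base : Continuous (base f) :=
  continuous_quot_mk.comp continuous_inl

lemma continuous_cone : Continuous fun p : A × I => cone f p.1 p.2 :=
  continuous_quot_mk.comp continuous_inr

/-- Maps out of a mapping cone. -/
def lift (u : X → Z) (v : A → I → Z) (h₁ : ∀ a, v a 1 = u (f a))
    (h₀ : ∀ a a', v a 0 = v a' 0) : MappingCone f → Z :=
  Quot.lift (Sum.elim u fun p => v p.1 p.2) (by
    rintro _ _ (⟨a, rfl, rfl⟩ | ⟨a, a', rfl, rfl⟩)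
    · exact h₁ a
    · exact h₀ a a')

lemma ind {p : MappingCone f → Prop} (hb : ∀ x, p (base f x)) (hc : ∀ a t, p (cone f a t)) (z) :
    p z := by
  rcases z with ⟨x | ⟨a, t⟩⟩
  exacts [hb x, hc a t]

lemma continuous_dom {g : MappingCone f → Z} (hb : Continuous fun x => g (base f x))
    (hc : Continuous fun p : A × I => g (cone f p.1 p.2)) : Continuous g :=
  isQuotientMap_quot_mk.continuous_iff.2 (continuous_sum_dom.2 ⟨hb, hc⟩)

lemma continuous_prod_dom {Y : Type*} [TopologicalSpace Y] [LocallyCompactSpace Y]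
    {g : Y × MappingCone f → Z}
    (hb : Continuous fun p : Y × X => g (p.1, base f p.2))
    (hc : Continuous fun p : Y × A × I => g (p.1, cone f p.2.1 p.2.2)) : Continuous g := by
  refine Topology.IsQuotientMap.continuous_lift_prod_right
    (f := (Quot.mk _ : X ⊕ A × I → MappingCone f)) isQuotientMap_quot_mk ?_
  rw [← (Homeomorph.prodSumDistrib (X := Y) (Y := X) (Z := A × I)).symm.comp_continuous_iff']
  exact continuous_sum_dom.2 ⟨hb, hc⟩

end MappingCone

end MappingCone

section JoinCone

open MappingCone

variable {E B : Type u} [TopologicalSpace E] {q : E → B}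

lemma FJSp.continuous_fst : Continuous fun x : FJSp q => x.1.1 :=
  _root_.continuous_fst.comp continuous_subtype_val

lemma FJSp.continuous_snd : Continuous fun x : FJSp q => x.1.2.1 :=
  _root_.continuous_fst.comp (_root_.continuous_snd.comp continuous_subtype_val)

lemma FJSp.continuous_param : Continuous fun x : FJSp q => x.1.2.2 :=
  _root_.continuous_snd.comp (_root_.continuous_snd.comp continuous_subtype_val)

lemma FJSp.continuous_mk {Z : Type*} [TopologicalSpace Z] {a b : Z → E} {t : Z → I}
    (ha : Continuous a) (hb : Continuous b) (ht : Continuous t) (h : ∀ z, q (a z) = q (b z)) :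
    Continuous fun z => (⟨(a z, b z, t z), h z⟩ : FJSp q) :=
  (ha.prodMk (hb.prodMk ht)).subtype_mk h

lemma FibreProd.continuous_mk {Z : Type*} [TopologicalSpace Z] {a b : Z → E}
    (ha : Continuous a) (hb : Continuous b) (h : ∀ z, q (a z) = q (b z)) :
    Continuous fun z => (⟨(a z, b z), h z⟩ : FibreProd q) :=
  (ha.prodMk hb).subtype_mk h

/-- The segment through a point of the join, starting at the apex of the cone over `E` for
`r = -1`, reaching the `t = 0` end of the join at `r = 0`, and the `t = 1` end at `r = 1`. -/
def joinSegment (x : FJSp q) (r : ℝ) : MappingCone (joinIncl q) :=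
  if r ≤ 0 then cone _ x.1.1 (Set.projIcc 0 1 zero_le_one (1 + r))
  else base _ (Quot.mk _ ⟨(x.1.1, x.1.2.1, Set.projIcc 0 1 zero_le_one r), x.2⟩)

lemma joinSegment_of_nonpos (x : FJSp q) {r : ℝ} (hr : r ≤ 0) :
    joinSegment x r = cone _ x.1.1 (Set.projIcc 0 1 zero_le_one (1 + r)) :=
  if_pos hr

lemma joinSegment_of_nonneg (x : FJSp q) {r : ℝ} (hr : 0 ≤ r) :
    joinSegment x r =
      base _ (Quot.mk _ ⟨(x.1.1, x.1.2.1, Set.projIcc 0 1 zero_le_one r), x.2⟩) := by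
  rcases hr.eq_or_lt with rfl | hr
  · rw [joinSegment_of_nonpos x le_rfl, add_zero, Set.projIcc_right, Set.projIcc_left]
    exact (cone_one _).trans (congrArg _ (Quot.sound (Or.inl ⟨rfl, rfl, rfl⟩)))
  · exact if_neg hr.not_ge

lemma joinSegment_coe (x : FJSp q) : joinSegment x x.1.2.2 = base _ (Quot.mk _ x) := by
  rw [joinSegment_of_nonneg x x.1.2.2.2.1, Set.projIcc_val]
  rfl

lemma joinSegment_one {x y : FJSp q} (h : x.1.2.1 = y.1.2.1) :
    joinSegment x 1 = joinSegment y 1 := by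
  rw [joinSegment_of_nonneg x zero_le_one, joinSegment_of_nonneg y zero_le_one]
  exact congrArg _ (Quot.sound (Or.inr ⟨Set.projIcc_right zero_le_one, Set.projIcc_right zero_le_one, h⟩))

lemma joinSegment_neg_one (x y : FJSp q) : joinSegment x (-1) = joinSegment y (-1) := by
  rw [joinSegment_of_nonpos x (by norm_num), joinSegment_of_nonpos y (by norm_num),
    add_neg_cancel, Set.projIcc_left]
  exact cone_zero _ _

lemma continuous_joinSegment : Continuous fun p : FJSp q × ℝ => joinSegment p.1 p.2 := by
  have hx : Continuous fun p : FJSp q × ℝ => p.1.1.1 :=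
    FJSp.continuous_fst.comp continuous_fst
  refine Continuous.if_le
    (continuous_cone.comp (hx.prodMk ((continuous_projIcc (h := zero_le_one)).comp
      (continuous_const.add continuous_snd))))
    (continuous_base.comp (continuous_quot_mk.comp (FJSp.continuous_mk hx
      (FJSp.continuous_snd.comp continuous_fst) (continuous_projIcc.comp continuous_snd) _)))
    continuous_snd continuous_const fun p hp => ?_
  rw [← joinSegment_of_nonpos p.1 hp.le, joinSegment_of_nonneg p.1 hp.ge]
  rfl

/-- The map `C_f → C_{π₁}` collapsing the cone over `E` to the apex. -/
def joinConeToProj : MappingCone (joinIncl q) → MappingCone (fibreProdFst q) :=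
  lift
    (Quot.lift (fun x => cone _ ⟨(x.1.2.1, x.1.1), x.2.symm⟩ x.1.2.2) (by
      rintro ⟨⟨a, b, t⟩, hx⟩ ⟨⟨a', b', t'⟩, hy⟩ (⟨h, h', -⟩ | ⟨h, h', hb⟩)
      · dsimp only at h h'
        subst h h'
        exact cone_zero _ _
      · dsimp only at h h' hb
        subst h h'
        exact (cone_one _).trans ((congrArg (base (fibreProdFst q)) hb).trans
          (cone_one (f := fibreProdFst q) ⟨(b', a'), hy.symm⟩).symm)))
    (fun e _ => cone _ ⟨(e, e), rfl⟩ 0) (fun _ => rfl) fun _ _ => cone_zero _ _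

lemma continuous_joinConeToProj : Continuous (joinConeToProj (q := q)) := by
  refine continuous_dom ?_ ?_
  · exact isQuotientMap_quot_mk.continuous_iff.2 (continuous_cone.comp
      ((FibreProd.continuous_mk FJSp.continuous_snd FJSp.continuous_fst _).prodMk
        FJSp.continuous_param))
  · exact continuous_cone.comp
      ((FibreProd.continuous_mk continuous_fst continuous_fst _).prodMk continuous_const)

/-- The map `C_{π₁} → C_f` stretching the cone over the fibre product along the segments of
the join followed by the segments of the cone over `E`. -/
def projConeToJoin : MappingCone (fibreProdFst q) → MappingCone (joinIncl q) :=
  lift (fun a => joinSegment ⟨(a, a, 1), rfl⟩ 1)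
    (fun p t => joinSegment ⟨(p.1.2, p.1.1, 1), p.2.symm⟩ (2 * t - 1))
    (fun p => by
      have h : (2 * ((1 : I) : ℝ) - 1) = 1 := by norm_num
      rw [h]
      exact joinSegment_one rfl)
    (fun p p' => by
      have h : (2 * ((0 : I) : ℝ) - 1) = -1 := by norm_num
      rw [h]
      exact joinSegment_neg_one _ _)

lemma continuous_projConeToJoin : Continuous (projConeToJoin (q := q)) := by
  have hv : Continuous fun p : FibreProd q => p.1 := continuous_subtype_val
  refine continuous_dom ?_ ?_
  · exact continuous_joinSegment.comp
      ((FJSp.continuous_mk continuous_id continuous_id continuous_const _).prodMk continuous_const)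
  · refine continuous_joinSegment.comp ((FJSp.continuous_mk
      (continuous_snd.comp (hv.comp continuous_fst))
      (continuous_fst.comp (hv.comp continuous_fst)) continuous_const _).prodMk ?_)
    exact (continuous_const.mul (continuous_subtype_val.comp continuous_snd)).sub continuous_const

lemma joinConeToProj_joinSegment (x : FJSp q) (r : ℝ) :
    joinConeToProj (joinSegment x r) =
      cone _ ⟨(x.1.2.1, x.1.1), x.2.symm⟩ (Set.projIcc 0 1 zero_le_one r) := by
  rcases le_total r 0 with hr | hr
  · rw [joinSegment_of_nonpos x hr, Set.projIcc_of_le_left _ hr]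
    exact cone_zero _ _
  · rw [joinSegment_of_nonneg x hr]
    rfl

/-- The deformation of `C_{π₁}` reparametrising the cone coordinate. -/
def projConeDeform (s : I) : MappingCone (fibreProdFst q) → MappingCone (fibreProdFst q) :=
  lift (base _)
    (fun p t => cone _ p (Set.projIcc 0 1 zero_le_one (t - s * (1 - t) : ℝ)))
    (fun p => by
      have h : (((1 : I) : ℝ) - s * (1 - ((1 : I) : ℝ))) = 1 := by norm_num
      rw [h, Set.projIcc_right]
      exact cone_one p)
    (fun p p' => by
      rw [Set.projIcc_of_le_left]
      · exact cone_zero _ _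
      · have := s.2.1
        norm_num [this])

lemma continuous_projConeDeform :
    Continuous fun p : I × MappingCone (fibreProdFst q) => projConeDeform p.1 p.2 := by
  refine continuous_prod_dom ?_ ?_
  · exact continuous_base.comp continuous_snd
  · refine continuous_cone.comp ((continuous_fst.comp continuous_snd).prodMk
      ((continuous_projIcc (h := zero_le_one)).comp ?_))
    fun_prop

/-- The deformation of `C_f` pushing the `t = 0` end of the join down the cone over `E`. -/
def joinConeDeform (s : I) : MappingCone (joinIncl q) → MappingCone (joinIncl q) :=
  lift
    (Quot.lift (fun x => joinSegment x (x.1.2.2 - s * (1 - x.1.2.2))) (by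
      rintro ⟨⟨a, b, t⟩, hx⟩ ⟨⟨a', b', t'⟩, hy⟩ (⟨h, h', ha⟩ | ⟨h, h', hb⟩)
      · dsimp only at h h' ha ⊢
        have hs : (((0 : I) : ℝ) - s * (1 - ((0 : I) : ℝ))) ≤ 0 := by
          have := s.2.1
          norm_num [this]
        subst h h' ha
        exact (joinSegment_of_nonpos _ hs).trans (joinSegment_of_nonpos ⟨(a, b', 0), hy⟩ hs).symm
      · dsimp only at h h' hb ⊢
        have hs : (((1 : I) : ℝ) - s * (1 - ((1 : I) : ℝ))) = 1 := by norm_num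
        rw [h, h', hs]
        exact joinSegment_one hb))
    (fun e u => cone _ e (u * σ s))
    (fun e => by
      have hs : (((0 : I) : ℝ) - s * (1 - ((0 : I) : ℝ))) ≤ 0 := by
        have := s.2.1
        norm_num [this]
      refine Eq.trans ?_ (joinSegment_of_nonpos ⟨(e, e, 0), rfl⟩ hs).symm
      have h : (1 + (((0 : I) : ℝ) - s * (1 - ((0 : I) : ℝ)))) = (σ s : I) := by
        simp [sub_eq_add_neg]
      rw [h, Set.projIcc_val, one_mul])
    (fun e e' => by
      rw [zero_mul]
      exact cone_zero _ _)

lemma continuous_joinConeDeform :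
    Continuous fun p : I × MappingCone (joinIncl q) => joinConeDeform p.1 p.2 := by
  refine continuous_prod_dom ?_ ?_
  · refine Topology.IsQuotientMap.continuous_lift_prod_right
      (f := (Quot.mk _ : FJSp q → FJoin q)) isQuotientMap_quot_mk ?_
    refine continuous_joinSegment.comp (continuous_snd.prodMk ?_)
    have ht : Continuous fun p : I × FJSp q => (p.2.1.2.2 : ℝ) :=
      continuous_subtype_val.comp (FJSp.continuous_param.comp continuous_snd)
    exact ht.sub ((continuous_subtype_val.comp continuous_fst).mul (continuous_const.sub ht))
  · have h : Continuous fun p : I × E × I => p.2.2 * σ p.1 := by fun_prop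
    exact continuous_cone.comp ((continuous_fst.comp continuous_snd).prodMk h)

lemma projConeDeform_zero (z : MappingCone (fibreProdFst q)) : projConeDeform 0 z = z := by
  induction z using MappingCone.ind with
  | hb x => rfl
  | hc p t =>
    refine congrArg (cone _ p) ?_
    simp

lemma projConeDeform_one (z : MappingCone (fibreProdFst q)) :
    projConeDeform 1 z = joinConeToProj (projConeToJoin z) := by
  induction z using MappingCone.ind with
  | hb a =>
    refine Eq.trans ?_ (joinConeToProj_joinSegment ⟨(a, a, 1), rfl⟩ 1).symm
    rw [Set.projIcc_right]
    exact (cone_one (f := fibreProdFst q) ⟨(a, a), rfl⟩).symm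
  | hc p t =>
    refine Eq.trans ?_ (joinConeToProj_joinSegment ⟨(p.1.2, p.1.1, 1), p.2.symm⟩ _).symm
    refine congrArg (fun r => cone _ p (Set.projIcc 0 1 zero_le_one r)) ?_
    rw [Set.Icc.coe_one]
    ring

lemma joinConeDeform_zero (z : MappingCone (joinIncl q)) : joinConeDeform 0 z = z := by
  induction z using MappingCone.ind with
  | hb x =>
    obtain ⟨x⟩ := x
    refine Eq.trans (congrArg (joinSegment x) ?_) (joinSegment_coe x)
    simp
  | hc e u =>
    refine congrArg (cone _ e) ?_
    simp

lemma joinConeDeform_one (z : MappingCone (joinIncl q)) :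
    joinConeDeform 1 z = projConeToJoin (joinConeToProj z) := by
  induction z using MappingCone.ind with
  | hb x =>
    obtain ⟨x⟩ := x
    refine congrArg (joinSegment x) ?_
    rw [Set.Icc.coe_one]
    ring
  | hc e u =>
    have h : (2 * ((0 : I) : ℝ) - 1) ≤ 0 := by norm_num
    refine Eq.trans ?_ (joinSegment_of_nonpos ⟨(e, e, 1), rfl⟩ h).symm
    refine congrArg (cone _ e) ?_
    simp

end JoinCone

/-- For a Hurewicz fibration `q : E → B`, the mapping cone of the natural
inclusion `E → E(1)` is homotopy equivalent to the mapping cone of the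
projection `π₁ : E ×_B E → E`. -/
theorem cone_joinIncl_homotopyEquiv_cone_proj
    {E B : Type u} [TopologicalSpace E] [TopologicalSpace B] (q : E → B)
    (hq : Continuous q) (hfib : IsHurewiczFibration q) :
    Nonempty (ContinuousMap.HomotopyEquiv (MappingCone (joinIncl q))
      (MappingCone (fibreProdFst q))) := by
  refine ⟨⟨⟨joinConeToProj, continuous_joinConeToProj⟩,
    ⟨projConeToJoin, continuous_projConeToJoin⟩, ?_, ?_⟩⟩
  · exact ContinuousMap.Homotopic.symm ⟨⟨⟨fun p => joinConeDeform p.1 p.2,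
      continuous_joinConeDeform⟩, joinConeDeform_zero, joinConeDeform_one⟩⟩
  · exact ContinuousMap.Homotopic.symm ⟨⟨⟨fun p => projConeDeform p.1 p.2,
      continuous_projConeDeform⟩, projConeDeform_zero, projConeDeform_one⟩⟩

end
end
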